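/- arXiv:2409.11970 — 3 statements merged into one kernel-verified Lean document; each statement's English description precedes it below -/
import Mathlib

section
/- Let G=(V,E) be a finite simple connected graph with vertex set V={v_1,…,v_k}, k ≥ 2. Suppose s is a nonnegative integer with s ≤ k+1 and H(x) is a polynomial with rational coefficients such that the identity of formal power series (1−x^2)^s · (1−x)^{k+1−s} · Ehr(P(G),x) = H(x) holds. Then H has degree exactly k+s−2 and H is palindromic, i.e. x^{k+s−2}·H(1/x) = H(x). -/
open Polynomial PowerSeries Pointwise

/-- The graph polytope `P(G)` of a simple graph `G`:
all points with coordinates in `[0,1]` such that `x i + x j ≤ 1` for every edge `ij`. -/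
def graphPolytope {V : Type*} (G : SimpleGraph V) : Set (V → ℝ) :=
  {x | (∀ i, 0 ≤ x i ∧ x i ≤ 1) ∧ ∀ i j, G.Adj i j → x i + x j ≤ 1}

/-- `ehr P n` is the number of lattice points in the `n`-th dilate `nP` of `P`. -/
noncomputable def ehr {V : Type*} (P : Set (V → ℝ)) (n : ℕ) : ℕ :=
  Set.ncard {m : V → ℤ | (fun i => (m i : ℝ)) ∈ (n : ℝ) • P}

/-- The Ehrhart series `Ehr(P, x) = Σ_{n ≥ 0} ehr(P,n) xⁿ` as a formal power series over `ℚ`. -/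
noncomputable def ehrSeries {V : Type*} (P : Set (V → ℝ)) : PowerSeries ℚ :=
  PowerSeries.mk fun n => (ehr P n : ℚ)


section Comb

variable {k : ℕ} (G : SimpleGraph (Fin k))

open Classical in
noncomputable def SS (U : Finset (Fin k)) (n : ℕ) : Finset (Fin k → ℕ) :=
  (Fintype.piFinset (fun i => if i ∈ U then Finset.range (n + 1) else {0})).filter
    (fun y => ∀ i ∈ U, ∀ j ∈ U, G.Adj i j → y i + y j ≤ n)

open Classical in
noncomputable def TT (U : Finset (Fin k)) (n : ℕ) : Finset (Fin k → ℕ) :=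
  (Fintype.piFinset (fun i => if i ∈ U then Finset.Ioo 0 n else {0})).filter
    (fun y => ∀ i ∈ U, ∀ j ∈ U, G.Adj i j → y i + y j < n)

open Classical in
noncomputable def XX (U : Finset (Fin k)) (n : ℕ) : Finset (Fin k → ℕ) :=
  (Fintype.piFinset (fun i => if i ∈ U then Finset.range (n + 1) else {0})).filter
    (fun y => ∀ i ∈ U, ∀ j ∈ U, G.Adj i j → y i = 0 ∨ y j = 0 ∨ y i + y j < n)

open Classical in
noncomputable def layerSets (U W : Finset (Fin k)) : Finset (Finset (Fin k)) :=
  W.powerset.filter (fun A => ∀ i ∈ A, ∀ j ∈ U, G.Adj i j → j ∈ W ∧ j ∉ A)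

lemma mem_SS {U : Finset (Fin k)} {n : ℕ} {y : Fin k → ℕ} : y ∈ SS G U n ↔
    (∀ i ∈ U, y i ≤ n) ∧ (∀ i, i ∉ U → y i = 0) ∧
      ∀ i ∈ U, ∀ j ∈ U, G.Adj i j → y i + y j ≤ n := by
  simp only [SS, Finset.mem_filter, Fintype.mem_piFinset]
  constructor
  · rintro ⟨h, h2⟩
    refine ⟨fun i hi => ?_, fun i hi => ?_, h2⟩
    · have := h i; simp [hi] at this; omega
    · have := h i; simpa [hi] using this
  · rintro ⟨h, h1, h2⟩
    refine ⟨fun i => ?_, h2⟩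
    by_cases hi : i ∈ U
    · have := h i hi; simp [hi]; omega
    · simp [hi, h1 i hi]

lemma mem_XX {U : Finset (Fin k)} {n : ℕ} {y : Fin k → ℕ} : y ∈ XX G U n ↔
    (∀ i ∈ U, y i ≤ n) ∧ (∀ i, i ∉ U → y i = 0) ∧
      ∀ i ∈ U, ∀ j ∈ U, G.Adj i j → y i = 0 ∨ y j = 0 ∨ y i + y j < n := by
  simp only [XX, Finset.mem_filter, Fintype.mem_piFinset]
  constructor
  · rintro ⟨h, h2⟩
    refine ⟨fun i hi => ?_, fun i hi => ?_, h2⟩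
    · have := h i; simp [hi] at this; omega
    · have := h i; simpa [hi] using this
  · rintro ⟨h, h1, h2⟩
    refine ⟨fun i => ?_, h2⟩
    by_cases hi : i ∈ U
    · have := h i hi; simp [hi]; omega
    · simp [hi, h1 i hi]

lemma mem_TT {U : Finset (Fin k)} {n : ℕ} {y : Fin k → ℕ} : y ∈ TT G U n ↔
    (∀ i ∈ U, 0 < y i ∧ y i < n) ∧ (∀ i, i ∉ U → y i = 0) ∧
      ∀ i ∈ U, ∀ j ∈ U, G.Adj i j → y i + y j < n := by
  simp only [TT, Finset.mem_filter, Fintype.mem_piFinset]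
  constructor
  · rintro ⟨h, h2⟩
    refine ⟨fun i hi => ?_, fun i hi => ?_, h2⟩
    · have := h i; simpa [hi] using this
    · have := h i; simpa [hi] using this
  · rintro ⟨h, h1, h2⟩
    refine ⟨fun i => ?_, h2⟩
    by_cases hi : i ∈ U
    · have := h i hi; simpa [hi] using this
    · simp [hi, h1 i hi]

lemma mem_CC {U W A : Finset (Fin k)} : A ∈ layerSets G U W ↔
    A ⊆ W ∧ ∀ i ∈ A, ∀ j ∈ U, G.Adj i j → j ∈ W ∧ j ∉ A := by
  simp [layerSets]

/-- boundary layer -/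
def bd (U : Finset (Fin k)) (n : ℕ) (y : Fin k → ℕ) : Finset (Fin k) :=
  U.filter (fun i => y i = 0 ∨ y i = n)

lemma SS_fiber (U W : Finset (Fin k)) (hW : W ⊆ U) (n : ℕ) :
    ((SS G U (n + 2)).filter (fun y => bd U (n + 2) y = W)).card =
      (layerSets G U W).card * (SS G (U \ W) n).card := by
  rw [← Finset.card_product]
  refine Finset.card_nbij'
    (fun y => (U.filter (fun i => y i = n + 2), fun i => if i ∈ U \ W then y i - 1 else 0))
    (fun p i => if i ∈ p.1 then n + 2 else if i ∈ U \ W then p.2 i + 1 else 0) ?_ ?_ ?_ ?_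
  · intro y hy
    simp only [Finset.coe_filter, Set.mem_ofPred_eq, mem_SS] at hy
    obtain ⟨⟨h1, h2, h3⟩, h4⟩ := hy
    have hm : ∀ i, i ∈ W ↔ i ∈ U ∧ (y i = 0 ∨ y i = n + 2) := by
      intro i; rw [← h4]; simp [bd]
    simp only [Finset.coe_product, Set.mem_prod, Finset.mem_coe, mem_CC, mem_SS]
    refine ⟨⟨?_, ?_⟩, ?_, ?_, ?_⟩
    · intro i; grind
    · intro i hi j hj hij
      have := h3 i (by grind) j hj hij
      grind
    · intro i hi; grind
    · intro i hi; grind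
    · intro i hi j hj hij
      have := h3 i (by grind) j (by grind) hij
      grind
  · rintro ⟨A, y⟩ hp
    simp only [Finset.coe_product, Set.mem_prod, Finset.mem_coe, mem_CC, mem_SS] at hp
    obtain ⟨⟨h1, h2⟩, h3, h4, h5⟩ := hp
    simp only [Finset.coe_filter, Set.mem_ofPred_eq, mem_SS]
    refine ⟨⟨?_, ?_, ?_⟩, ?_⟩
    · intro i hi; grind
    · intro i hi; grind
    · intro i hi j hj hij
      have a1 := h2 i
      have a2 := h2 j
      have a3 := h5 i
      have := hij.symm
      grind
    · ext i
      simp only [bd, Finset.mem_filter]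
      grind
  · intro y hy
    simp only [Finset.coe_filter, Set.mem_ofPred_eq, mem_SS] at hy
    obtain ⟨⟨h1, h2, h3⟩, h4⟩ := hy
    have hm : ∀ i, i ∈ W ↔ i ∈ U ∧ (y i = 0 ∨ y i = n + 2) := by
      intro i; rw [← h4]; simp [bd]
    funext i
    grind
  · rintro ⟨A, y⟩ hp
    simp only [Finset.coe_product, Set.mem_prod, Finset.mem_coe, mem_CC, mem_SS] at hp
    obtain ⟨⟨h1, h2⟩, h3, h4, h5⟩ := hp
    refine Prod.ext ?_ ?_
    · ext i
      grind
    · funext i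
      grind

lemma XX_fiber (U W : Finset (Fin k)) (hW : W ⊆ U) (n : ℕ) (hn : 0 < n) :
    ((XX G U n).filter (fun y => bd U n y = W)).card =
      (layerSets G U W).card * (TT G (U \ W) n).card := by
  rw [← Finset.card_product]
  refine Finset.card_nbij'
    (fun y => (U.filter (fun i => y i = n), fun i => if i ∈ U \ W then y i else 0))
    (fun p i => if i ∈ p.1 then n else if i ∈ U \ W then p.2 i else 0) ?_ ?_ ?_ ?_
  · intro y hy
    simp only [Finset.coe_filter, Set.mem_ofPred_eq, mem_XX] at hy
    obtain ⟨⟨h1, h2, h3⟩, h4⟩ := hy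
    have hm : ∀ i, i ∈ W ↔ i ∈ U ∧ (y i = 0 ∨ y i = n) := by
      intro i; rw [← h4]; simp [bd]
    simp only [Finset.coe_product, Set.mem_prod, Finset.mem_coe, mem_CC, mem_TT]
    refine ⟨⟨?_, ?_⟩, ?_, ?_, ?_⟩
    · intro i; grind
    · intro i hi j hj hij
      have := h3 i (by grind) j hj hij
      grind
    · intro i hi; grind
    · intro i hi; grind
    · intro i hi j hj hij
      have := h3 i (by grind) j (by grind) hij
      grind
  · rintro ⟨A, y⟩ hp
    simp only [Finset.coe_product, Set.mem_prod, Finset.mem_coe, mem_CC, mem_TT] at hp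
    obtain ⟨⟨h1, h2⟩, h3, h4, h5⟩ := hp
    simp only [Finset.coe_filter, Set.mem_ofPred_eq, mem_XX]
    refine ⟨⟨?_, ?_, ?_⟩, ?_⟩
    · intro i hi; grind
    · intro i hi; grind
    · intro i hi j hj hij
      have a1 := h2 i
      have a2 := h2 j
      have a3 := h5 i
      have := hij.symm
      grind
    · ext i
      simp only [bd, Finset.mem_filter]
      grind
  · intro y hy
    simp only [Finset.coe_filter, Set.mem_ofPred_eq, mem_XX] at hy
    obtain ⟨⟨h1, h2, h3⟩, h4⟩ := hy
    have hm : ∀ i, i ∈ W ↔ i ∈ U ∧ (y i = 0 ∨ y i = n) := by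
      intro i; rw [← h4]; simp [bd]
    funext i
    grind
  · rintro ⟨A, y⟩ hp
    simp only [Finset.coe_product, Set.mem_prod, Finset.mem_coe, mem_CC, mem_TT] at hp
    obtain ⟨⟨h1, h2⟩, h3, h4, h5⟩ := hp
    refine Prod.ext ?_ ?_
    · ext i
      grind
    · funext i
      grind

lemma SS_rec (U : Finset (Fin k)) (n : ℕ) :
    (SS G U (n + 2)).card =
      ∑ W ∈ U.powerset, (layerSets G U W).card * (SS G (U \ W) n).card := by
  rw [Finset.card_eq_sum_card_fiberwise (f := bd U (n + 2)) (t := U.powerset)]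
  · refine Finset.sum_congr rfl fun W hW => ?_
    rw [SS_fiber G U W (Finset.mem_powerset.1 hW)]
  · intro y _
    exact Finset.mem_coe.2 (Finset.mem_powerset.2 (Finset.filter_subset _ _))

lemma SS_zero (U : Finset (Fin k)) : (SS G U 0).card = 1 := by
  rw [Finset.card_eq_one]
  refine ⟨fun _ => 0, ?_⟩
  ext y
  simp only [mem_SS, Finset.mem_singleton]
  constructor
  · rintro ⟨h1, h2, -⟩
    funext i
    by_cases hi : i ∈ U
    · have := h1 i hi; omega
    · exact h2 i hi
  · rintro rfl
    simp

lemma SS_one (U : Finset (Fin k)) : (SS G U 1).card = (layerSets G U U).card := by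
  refine Finset.card_nbij' (fun y => U.filter (fun i => y i = 1))
    (fun A i => if i ∈ A then 1 else 0) ?_ ?_ ?_ ?_
  · intro y hy
    simp only [Finset.mem_coe, mem_SS] at hy
    obtain ⟨h1, h2, h3⟩ := hy
    simp only [Finset.mem_coe, mem_CC]
    refine ⟨by grind, fun i hi j hj hij => ?_⟩
    have := h3 i (by grind) j hj hij
    grind
  · intro A hA
    simp only [Finset.mem_coe, mem_CC] at hA
    obtain ⟨h1, h2⟩ := hA
    simp only [Finset.mem_coe, mem_SS]
    refine ⟨by grind, by grind, fun i hi j hj hij => ?_⟩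
    have := h2 i
    grind
  · intro y hy
    simp only [Finset.mem_coe, mem_SS] at hy
    obtain ⟨h1, h2, h3⟩ := hy
    funext i
    grind
  · intro A hA
    simp only [Finset.mem_coe, mem_CC] at hA
    obtain ⟨h1, h2⟩ := hA
    ext i
    grind

lemma XX_sum (U : Finset (Fin k)) (n : ℕ) (hn : 0 < n) :
    ∑ y ∈ XX G U n, (-1 : ℚ) ^ (bd U n y).card =
      ∑ W ∈ U.powerset, (-1 : ℚ) ^ W.card * ((layerSets G U W).card * (TT G (U \ W) n).card) := by
  rw [← Finset.sum_fiberwise_of_maps_to (g := bd U n) (t := U.powerset)]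
  · refine Finset.sum_congr rfl fun W hW => ?_
    rw [← Nat.cast_mul, ← XX_fiber G U W (Finset.mem_powerset.1 hW) n hn]
    rw [Finset.sum_congr rfl (g := fun _ => (-1 : ℚ) ^ W.card)]
    · simp [mul_comm]
    · intro y hy
      rw [(Finset.mem_filter.1 hy).2]
  · intro y _
    simp [bd]

/-- cancel by toggling the smallest active coordinate -/
lemma toggle_cancel (U : Finset (Fin k)) (X : Finset (Fin k → ℕ)) (w : (Fin k → ℕ) → ℚ)
    (t : ℕ → ℕ) (p : ℕ → Prop) [DecidablePred p]
    (hp : ∀ a, p a → p (t a)) (ht : ∀ a, p a → t (t a) = a) (hne : ∀ a, p a → t a ≠ a)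
    (hX : ∀ y ∈ X, ∀ i ∈ U, p (y i) → Function.update y i (t (y i)) ∈ X)
    (hw : ∀ y ∈ X, ∀ i ∈ U, p (y i) → w y + w (Function.update y i (t (y i))) = 0) :
    ∑ y ∈ X, w y = ∑ y ∈ X.filter (fun y => ∀ i ∈ U, ¬ p (y i)), w y := by
  rw [← Finset.sum_filter_add_sum_filter_not X (fun y => ∀ i ∈ U, ¬ p (y i))]
  rw [add_eq_left]
  have hN : ∀ y ∈ X.filter (fun y => ¬ ∀ i ∈ U, ¬ p (y i)),
      (U.filter (fun i => p (y i))).Nonempty := by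
    intro y hy
    have := (Finset.mem_filter.1 hy).2
    push Not at this
    obtain ⟨i, hi, h⟩ := this
    exact ⟨i, Finset.mem_filter.2 ⟨hi, h⟩⟩
  have hm : ∀ y (hy : y ∈ X.filter (fun y => ¬ ∀ i ∈ U, ¬ p (y i))),
      (U.filter (fun i => p (y i))).min' (hN y hy) ∈ U ∧
      p (y ((U.filter (fun i => p (y i))).min' (hN y hy))) := fun y hy =>
    Finset.mem_filter.1 (Finset.min'_mem _ (hN y hy))
  have hfil : ∀ (y : Fin k → ℕ) (i : Fin k), p (y i) →
      U.filter (fun j => p (Function.update y i (t (y i)) j)) = U.filter (fun j => p (y j)) := by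
    intro y i hi
    refine Finset.filter_congr fun j _ => ?_
    by_cases h : j = i
    · subst h; simp [hi, hp]
    · simp [Function.update_of_ne h]
  refine Finset.sum_involution (fun y hy => Function.update y
    ((U.filter (fun i => p (y i))).min' (hN y hy))
    (t (y ((U.filter (fun i => p (y i))).min' (hN y hy))))) ?_ ?_ ?_ ?_
  · intro y hy
    exact hw y (Finset.mem_filter.1 hy).1 _ (hm y hy).1 (hm y hy).2
  · intro y hy _ h
    exact hne _ (hm y hy).2 (by simpa using congrFun h ((U.filter (fun i => p (y i))).min' (hN y hy)))
  · intro y hy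
    refine Finset.mem_filter.2 ⟨hX y (Finset.mem_filter.1 hy).1 _ (hm y hy).1 (hm y hy).2, ?_⟩
    push Not
    exact ⟨_, (hm y hy).1, by simpa using hp _ (hm y hy).2⟩
  · intro y hy
    simp only [hfil y _ (hm y hy).2]
    simp [ht _ (hm y hy).2]

lemma bd_toggle (U : Finset (Fin k)) (n : ℕ) (y : Fin k → ℕ) (i : Fin k) (hi : i ∈ U) (b : ℕ)
    (h : ¬ ((b = 0 ∨ b = n) ↔ (y i = 0 ∨ y i = n))) :
    (-1 : ℚ) ^ (bd U n y).card + (-1 : ℚ) ^ (bd U n (Function.update y i b)).card = 0 := by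
  have key : ∀ (z : Fin k → ℕ), bd U n z = bd (U.erase i) n z ∪ (if z i = 0 ∨ z i = n then {i} else ∅) := by
    intro z
    ext j
    simp only [bd, Finset.mem_filter, Finset.mem_union, Finset.mem_erase]
    grind
  have h2 : bd (U.erase i) n (Function.update y i b) = bd (U.erase i) n y := by
    refine Finset.filter_congr fun j hj => ?_
    rw [Function.update_of_ne (Finset.ne_of_mem_erase hj)]
  have h3 : i ∉ bd (U.erase i) n y := by simp [bd]
  rw [key y, key (Function.update y i b), h2]
  simp only [Function.update_self]
  by_cases h4 : y i = 0 ∨ y i = n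
  · have h5 : ¬ (b = 0 ∨ b = n) := by tauto
    rw [if_pos h4, if_neg h5, Finset.card_union_of_disjoint (Finset.disjoint_singleton_right.2 h3)]
    simp only [Finset.union_empty, Finset.card_singleton, pow_succ]
    ring
  · have h5 : (b = 0 ∨ b = n) := by tauto
    rw [if_neg h4, if_pos h5, Finset.card_union_of_disjoint (Finset.disjoint_singleton_right.2 h3)]
    simp only [Finset.union_empty, Finset.card_singleton, pow_succ]
    ring

lemma XX_step1 (U : Finset (Fin k)) (n : ℕ) :
    ∑ y ∈ XX G U (n + 2), (-1 : ℚ) ^ (bd U (n + 2) y).card =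
    ∑ y ∈ (XX G U (n + 2)).filter (fun y => ∀ i ∈ U, ¬ (n + 1 ≤ y i ∧ y i ≤ n + 2)),
      (-1 : ℚ) ^ (bd U (n + 2) y).card := by
  refine toggle_cancel U _ _ (fun a => 2 * n + 3 - a) (fun a => n + 1 ≤ a ∧ a ≤ n + 2)
    (by intro a; omega) (by intro a; omega)
    (by intro a; omega) ?_ ?_
  · intro y hy i hi hpi
    rw [mem_XX] at hy ⊢
    obtain ⟨h1, h2, h3⟩ := hy
    refine ⟨?_, ?_, ?_⟩
    · intro j hj
      have := h1 j hj
      simp only [Function.update_apply]; split_ifs <;> omega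
    · intro j hj
      have := h2 j hj
      simp only [Function.update_apply]; grind
    · intro a ha b hb hab
      have := h3 a ha b hb hab
      have := hab.ne
      simp only [Function.update_apply]; grind
  · intro y hy i hi hpi
    apply bd_toggle _ _ _ _ hi
    omega

lemma XX_two (U : Finset (Fin k)) :
    ∑ y ∈ XX G U 2, (-1 : ℚ) ^ (bd U 2 y).card = (-1) ^ U.card := by
  rw [XX_step1 G U 0]
  rw [Finset.sum_eq_single (fun _ => 0)]
  · simp [bd]
  · intro y hy hne
    exfalso
    apply hne
    rw [Finset.mem_filter, mem_XX] at hy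
    funext i
    by_cases hi : i ∈ U
    · have := hy.2 i hi
      have := hy.1.1 i hi
      omega
    · exact hy.1.2.1 i hi
  · intro h
    exfalso
    apply h
    simp [mem_XX]

lemma XX_three (U : Finset (Fin k)) (n : ℕ) :
    ∑ y ∈ XX G U (n + 3), (-1 : ℚ) ^ (bd U (n + 3) y).card = (TT G U (n + 1)).card := by
  rw [XX_step1 G U (n + 1)]
  rw [toggle_cancel U _ _ (fun a => 1 - a) (fun a => a ≤ 1)
    (by intro a; omega) (by intro a; omega)
    (by intro a; omega) ?_ ?_]
  · rw [Finset.sum_congr rfl (g := fun _ => (1 : ℚ))]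
    · rw [Finset.sum_const, nsmul_eq_mul, mul_one]
      congr 1
      refine Finset.card_nbij' (fun y i => y i - 1) (fun y i => if i ∈ U then y i + 1 else 0)
        ?_ ?_ ?_ ?_
      · intro y hy
        simp only [Finset.mem_coe, Finset.mem_filter, mem_XX] at hy
        obtain ⟨⟨⟨h1, h2, h3⟩, h4⟩, h5⟩ := hy
        simp only [Finset.mem_coe, mem_TT]
        refine ⟨by grind, by grind, fun i hi j hj hij => ?_⟩
        have := h3 i hi j hj hij
        have := h5 i hi
        have := h5 j hj
        omega
      · intro y hy
        simp only [Finset.mem_coe, mem_TT] at hy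
        obtain ⟨h1, h2, h3⟩ := hy
        simp only [Finset.mem_coe, Finset.mem_filter, mem_XX]
        refine ⟨⟨⟨by grind, by grind, fun i hi j hj hij => ?_⟩, by grind⟩, by grind⟩
        have := h3 i hi j hj hij
        grind
      · intro y hy
        simp only [Finset.mem_coe, Finset.mem_filter, mem_XX] at hy
        obtain ⟨⟨⟨h1, h2, h3⟩, h4⟩, h5⟩ := hy
        funext i
        grind
      · intro y hy
        simp only [Finset.mem_coe, mem_TT] at hy
        obtain ⟨h1, h2, h3⟩ := hy
        funext i
        grind
    · intro y hy
      simp only [Finset.mem_filter, mem_XX] at hy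
      obtain ⟨⟨⟨h1, h2, h3⟩, h4⟩, h5⟩ := hy
      have : bd U (n + 3) y = ∅ := by
        rw [bd, Finset.filter_eq_empty_iff]
        grind
      simp [this]
  · intro y hy i hi hpi
    rw [Finset.mem_filter, mem_XX] at hy ⊢
    obtain ⟨⟨h1, h2, h3⟩, h4⟩ := hy
    refine ⟨⟨?_, ?_, ?_⟩, ?_⟩
    · intro j hj
      have := h1 j hj
      simp only [Function.update_apply]; split_ifs <;> omega
    · intro j hj
      have := h2 j hj
      simp only [Function.update_apply]; grind
    · intro a ha b hb hab
      have := h3 a ha b hb hab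
      have := hab.ne
      have := h4 a ha
      have := h4 b hb
      have := h1 a ha
      have := h1 b hb
      simp only [Function.update_apply]; grind
    · intro a ha
      have := h4 a ha
      simp only [Function.update_apply]; grind
  · intro y hy i hi hpi
    apply bd_toggle _ _ _ _ hi
    omega

lemma TT_one (U : Finset (Fin k)) : (TT G U 1).card = if U = ∅ then 1 else 0 := by
  split_ifs with h
  · subst h
    rw [Finset.card_eq_one]
    refine ⟨fun _ => 0, ?_⟩
    ext y
    simp only [mem_TT, Finset.mem_singleton]
    constructor
    · rintro ⟨-, h2, -⟩
      funext i
      exact h2 i (by simp)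
    · rintro rfl
      simp
  · rw [Finset.card_eq_zero, Finset.eq_empty_iff_forall_notMem]
    intro y hy
    obtain ⟨i, hi⟩ := Finset.nonempty_iff_ne_empty.2 h
    have := ((mem_TT G).1 hy).1 i hi
    omega

end Comb

section Series

/-- common denominator -/
noncomputable def DD (u : ℕ) : ℚ[X] := (1 - Polynomial.X) * (1 - Polynomial.X ^ 2) ^ u

lemma deg_one_sub_X_pow (m : ℕ) : (1 - Polynomial.X ^ m : ℚ[X]).natDegree ≤ m := by
  refine (Polynomial.natDegree_sub_le _ _).trans ?_
  simp

lemma reflect_one_sub_X_pow (m : ℕ) :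
    (1 - Polynomial.X ^ m : ℚ[X]).reflect m = -(1 - Polynomial.X ^ m) := by
  rw [Polynomial.reflect_sub, Polynomial.reflect_one, Polynomial.reflect_monomial, Polynomial.revAt_le le_rfl]
  simp

lemma reflect_pow_aux (p : ℚ[X]) (m : ℕ) (hp : p.natDegree ≤ m) (hr : p.reflect m = -p) (u : ℕ) :
    (p ^ u).natDegree ≤ m * u ∧ (p ^ u).reflect (m * u) = (-1) ^ u * p ^ u := by
  induction u with
  | zero => simp
  | succ u ih =>
    constructor
    · refine Polynomial.natDegree_pow_le.trans ?_
      rw [mul_comm]; gcongr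
    · rw [pow_succ, mul_add, mul_one, Polynomial.reflect_mul _ _ ih.1 hp, ih.2, hr]
      ring

lemma pow_two_deg (u : ℕ) : ((1 - Polynomial.X ^ 2 : ℚ[X]) ^ u).natDegree ≤ 2 * u :=
  (reflect_pow_aux _ 2 (deg_one_sub_X_pow 2) (reflect_one_sub_X_pow 2) u).1

lemma pow_two_reflect (u : ℕ) : ((1 - Polynomial.X ^ 2 : ℚ[X]) ^ u).reflect (2 * u) =
    (-1) ^ u * (1 - Polynomial.X ^ 2) ^ u :=
  (reflect_pow_aux _ 2 (deg_one_sub_X_pow 2) (reflect_one_sub_X_pow 2) u).2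

lemma pow_one_deg (u : ℕ) : ((1 - Polynomial.X : ℚ[X]) ^ u).natDegree ≤ u := by
  have := (reflect_pow_aux _ 1 (deg_one_sub_X_pow 1) (reflect_one_sub_X_pow 1) u).1
  simpa using this

lemma pow_one_reflect (u : ℕ) : ((1 - Polynomial.X : ℚ[X]) ^ u).reflect u =
    (-1) ^ u * (1 - Polynomial.X) ^ u := by
  have := (reflect_pow_aux _ 1 (deg_one_sub_X_pow 1) (reflect_one_sub_X_pow 1) u).2
  simpa using this

lemma QQ_deg (a b : ℕ) : ((1 - Polynomial.X ^ 2 : ℚ[X]) ^ a * (1 - Polynomial.X) ^ b).natDegree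
    ≤ 2 * a + b :=
  Polynomial.natDegree_mul_le.trans (add_le_add (pow_two_deg a) (pow_one_deg b))

lemma QQ_reflect (a b : ℕ) :
    ((1 - Polynomial.X ^ 2 : ℚ[X]) ^ a * (1 - Polynomial.X) ^ b).reflect (2 * a + b) =
    (-1) ^ (a + b) * ((1 - Polynomial.X ^ 2 : ℚ[X]) ^ a * (1 - Polynomial.X) ^ b) := by
  rw [Polynomial.reflect_mul _ _ (pow_two_deg a) (pow_one_deg b), pow_two_reflect,
    pow_one_reflect]
  ring

lemma DD_eq (u : ℕ) : DD u = (1 - Polynomial.X ^ 2 : ℚ[X]) ^ u * (1 - Polynomial.X) ^ 1 := by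
  rw [DD]; ring

lemma DD_deg (u : ℕ) : (DD u).natDegree ≤ 2 * u + 1 := by
  rw [DD_eq]; exact QQ_deg u 1

lemma DD_reflect (u : ℕ) : (DD u).reflect (2 * u + 1) = (-1) ^ (u + 1) * DD u := by
  rw [DD_eq]; exact QQ_reflect u 1

lemma DD_succ (u : ℕ) : DD (u + 1) = DD u * (1 - Polynomial.X ^ 2) := by
  rw [DD, DD]; ring

/-- `f(1/x) = (-1)^(u+1) g(x)` with denominator `DD u`. -/
def Rcp (u : ℕ) (f g : PowerSeries ℚ) : Prop :=
  ∃ N : ℚ[X], N.natDegree ≤ 2 * u + 1 ∧ (DD u : PowerSeries ℚ) * f = N ∧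
    (DD u : PowerSeries ℚ) * g = (N.reflect (2 * u + 1) : ℚ[X])

lemma Rcp.zero (u : ℕ) : Rcp u 0 0 := ⟨0, by simp, by simp, by simp⟩

lemma Rcp.add {u : ℕ} {f g f' g' : PowerSeries ℚ} (h : Rcp u f g) (h' : Rcp u f' g') :
    Rcp u (f + f') (g + g') := by
  obtain ⟨N, a, b, c⟩ := h
  obtain ⟨N', a', b', c'⟩ := h'
  refine ⟨N + N', Polynomial.natDegree_add_le_of_degree_le a a', ?_, ?_⟩
  · rw [mul_add, b, b', Polynomial.coe_add]
  · rw [mul_add, c, c', Polynomial.reflect_add, Polynomial.coe_add]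

lemma Rcp.smul {u : ℕ} {f g : PowerSeries ℚ} (r : ℚ) (h : Rcp u f g) :
    Rcp u (PowerSeries.C r * f) (PowerSeries.C r * g) := by
  obtain ⟨N, a, b, c⟩ := h
  refine ⟨Polynomial.C r * N, (Polynomial.natDegree_C_mul_le _ _).trans a, ?_, ?_⟩
  · rw [mul_left_comm, b, Polynomial.coe_mul, Polynomial.coe_C]
  · rw [mul_left_comm, c, Polynomial.reflect_C_mul, Polynomial.coe_mul, Polynomial.coe_C]

lemma Rcp.sum {ι : Type*} {u : ℕ} (s : Finset ι) {f g : ι → PowerSeries ℚ}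
    (h : ∀ i ∈ s, Rcp u (f i) (g i)) : Rcp u (∑ i ∈ s, f i) (∑ i ∈ s, g i) := by
  classical
  induction s using Finset.induction_on with
  | empty => simpa using Rcp.zero u
  | insert a s ha ih =>
    rw [Finset.sum_insert ha, Finset.sum_insert ha]
    exact (h a (by simp)).add (ih fun i hi => h i (by simp [hi]))

lemma Rcp.succ {u : ℕ} {f g : PowerSeries ℚ} (h : Rcp u f g) : Rcp (u + 1) f (-g) := by
  obtain ⟨N, a, b, c⟩ := h
  refine ⟨N * (1 - Polynomial.X ^ 2), ?_, ?_, ?_⟩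
  · refine Polynomial.natDegree_mul_le.trans ?_
    have := deg_one_sub_X_pow 2
    omega
  · rw [DD_succ, Polynomial.coe_mul, Polynomial.coe_mul, ← b]; ring
  · rw [show 2 * (u + 1) + 1 = (2 * u + 1) + 2 by ring,
      Polynomial.reflect_mul _ _ a (deg_one_sub_X_pow 2), reflect_one_sub_X_pow,
      Polynomial.coe_mul, ← c, DD_succ, Polynomial.coe_mul, Polynomial.coe_neg]
    ring

lemma Rcp.lift {u : ℕ} {f g : PowerSeries ℚ} (h : Rcp u f g) (j : ℕ) :
    Rcp (u + j) f ((-1) ^ j * g) := by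
  induction j with
  | zero => simpa using h
  | succ j ih =>
    have := ih.succ
    rwa [show -((-1) ^ j * g) = (-1) ^ (j + 1) * g by ring] at this

lemma Rcp.step {u : ℕ} {f g f' g' : PowerSeries ℚ} (h : Rcp u f g) (c : ℚ)
    (hf : (1 - PowerSeries.X ^ 2) * f' = PowerSeries.X ^ 2 * f + 1 + PowerSeries.C c * PowerSeries.X)
    (hg : (1 - PowerSeries.X ^ 2) * g' = g + (-1) ^ (u + 1) *
      (PowerSeries.X ^ 2 + PowerSeries.C c * PowerSeries.X)) :
    Rcp (u + 1) f' g' := by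
  obtain ⟨N, a, b, d⟩ := h
  have e1 : (1 + Polynomial.C c * Polynomial.X : ℚ[X]).natDegree ≤ 2 := by
    compute_degree
    norm_num
  have e2 : (1 + Polynomial.C c * Polynomial.X : ℚ[X]).reflect 2 =
      Polynomial.X ^ 2 + Polynomial.C c * Polynomial.X := by
    rw [Polynomial.reflect_add, Polynomial.reflect_one, Polynomial.reflect_C_mul]
    congr 2
    have := Polynomial.reflect_monomial (R := ℚ) 2 1
    rw [Polynomial.revAt_le (by norm_num)] at this
    simpa using this
  have e3 : (Polynomial.X ^ 2 : ℚ[X]).reflect 2 = 1 := by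
    have := Polynomial.reflect_monomial (R := ℚ) 2 2
    rw [Polynomial.revAt_le (by norm_num)] at this
    simpa using this
  refine ⟨N * Polynomial.X ^ 2 + DD u * (1 + Polynomial.C c * Polynomial.X), ?_, ?_, ?_⟩
  · refine Polynomial.natDegree_add_le_of_degree_le ?_ ?_
    · refine Polynomial.natDegree_mul_le.trans ?_
      simp; omega
    · refine Polynomial.natDegree_mul_le.trans ?_
      have := DD_deg u
      omega
  · rw [DD_succ, Polynomial.coe_mul, mul_assoc]
    simp only [Polynomial.coe_sub, Polynomial.coe_one, Polynomial.coe_pow, Polynomial.coe_X,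
      Polynomial.coe_add, Polynomial.coe_mul, Polynomial.coe_C]
    rw [hf, ← b]
    ring
  · rw [show 2 * (u + 1) + 1 = (2 * u + 1) + 2 by ring, Polynomial.reflect_add,
      Polynomial.reflect_mul _ _ a (by simp), Polynomial.reflect_mul _ _ (DD_deg u) e1, e2, e3,
      DD_reflect, DD_succ, Polynomial.coe_mul, mul_assoc]
    simp only [Polynomial.coe_sub, Polynomial.coe_one, Polynomial.coe_pow, Polynomial.coe_X,
      Polynomial.coe_add, Polynomial.coe_mul, Polynomial.coe_C, Polynomial.coe_neg]
    rw [hg, ← d]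
    ring

variable {k : ℕ} (G : SimpleGraph (Fin k))

noncomputable def ES (U : Finset (Fin k)) : PowerSeries ℚ :=
  PowerSeries.mk fun n => ((SS G U n).card : ℚ)

noncomputable def ET (U : Finset (Fin k)) : PowerSeries ℚ :=
  PowerSeries.mk fun n => if n = 0 then 0 else ((TT G U n).card : ℚ)

lemma ES_rec (U : Finset (Fin k)) : ES G U =
    PowerSeries.X ^ 2 * (∑ W ∈ U.powerset, PowerSeries.C ((layerSets G U W).card : ℚ) * ES G (U \ W))
      + 1 + PowerSeries.C ((layerSets G U U).card : ℚ) * PowerSeries.X := by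
  ext n
  rcases n with _ | _ | n
  · simp [ES, SS_zero, PowerSeries.coeff_X_pow_mul']
  · simp [ES, SS_one, PowerSeries.coeff_X_pow_mul', PowerSeries.coeff_one]
  · rw [ES, PowerSeries.coeff_mk]
    simp only [map_add, map_sum, PowerSeries.coeff_X_pow_mul', PowerSeries.coeff_C_mul,
      PowerSeries.coeff_one, PowerSeries.coeff_X, SS_rec, ES, PowerSeries.coeff_mk]
    simp

lemma ET_rec (U : Finset (Fin k)) : PowerSeries.X ^ 2 * ET G U =
    (∑ W ∈ U.powerset, PowerSeries.C ((-1) ^ W.card * ((layerSets G U W).card : ℚ)) * ET G (U \ W))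
      - PowerSeries.C ((-1) ^ U.card) *
        (PowerSeries.X ^ 2 + PowerSeries.C ((layerSets G U U).card : ℚ) * PowerSeries.X) := by
  ext n
  simp only [map_sub, map_sum, PowerSeries.coeff_C_mul, map_add]
  rcases n with _ | _ | _ | n
  · simp [ET, PowerSeries.coeff_X_pow_mul', PowerSeries.coeff_X_pow]
  · have : ∑ W ∈ U.powerset, ((-1) ^ W.card * ((layerSets G U W).card : ℚ)) *
        PowerSeries.coeff 1 (ET G (U \ W)) = (-1) ^ U.card * (layerSets G U U).card := by
      rw [Finset.sum_eq_single U]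
      · simp [ET, TT_one]
      · intro W hW hne
        have : U \ W ≠ ∅ := by
          intro h
          exact hne (Finset.Subset.antisymm (Finset.mem_powerset.1 hW)
            (Finset.sdiff_eq_empty_iff_subset.1 h))
        simp [ET, TT_one, this]
      · simp
    rw [zero_add, this]
    simp [PowerSeries.coeff_X_pow_mul', PowerSeries.coeff_X_pow]
  · have := XX_two G U
    rw [XX_sum G U 2 (by norm_num)] at this
    simp only [← mul_assoc] at this
    simp [ET, PowerSeries.coeff_X_pow_mul', PowerSeries.coeff_X_pow, PowerSeries.coeff_X, this]
  · have := XX_three G U n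
    rw [XX_sum G U (n + 3) (by norm_num)] at this
    simp only [← mul_assoc] at this
    simp [ET, PowerSeries.coeff_X_pow_mul', PowerSeries.coeff_X_pow, PowerSeries.coeff_X, this]

lemma SS_empty (n : ℕ) : (SS G ∅ n).card = 1 := by
  rw [Finset.card_eq_one]
  refine ⟨fun _ => 0, ?_⟩
  ext y
  simp only [mem_SS, Finset.mem_singleton]
  constructor
  · rintro ⟨-, h2, -⟩
    funext i
    exact h2 i (by simp)
  · rintro rfl
    simp

lemma TT_empty (n : ℕ) : (TT G ∅ n).card = 1 := by
  rw [Finset.card_eq_one]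
  refine ⟨fun _ => 0, ?_⟩
  ext y
  simp only [mem_TT, Finset.mem_singleton]
  constructor
  · rintro ⟨-, h2, -⟩
    funext i
    exact h2 i (by simp)
  · rintro rfl
    simp

lemma CC_empty (U : Finset (Fin k)) : (layerSets G U ∅).card = 1 := by
  rw [Finset.card_eq_one]
  refine ⟨∅, ?_⟩
  ext A
  simp only [mem_CC, Finset.mem_singleton, Finset.subset_empty]
  constructor
  · exact fun h => h.1
  · rintro rfl
    simp

lemma recip_empty : Rcp 0 (ES G ∅) (ET G ∅) := by
  refine ⟨1, by simp, ?_, ?_⟩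
  · simp only [DD, ES, SS_empty]
    ext n
    rcases n with _ | n
    · simp
    · simp [sub_mul, PowerSeries.coeff_one, PowerSeries.coeff_succ_X_mul]
  · simp only [DD, ET, TT_empty]
    rw [Polynomial.reflect_one]
    ext n
    rcases n with _ | _ | n
    · simp
    · simp [sub_mul, PowerSeries.coeff_succ_X_mul]
    · simp [sub_mul, PowerSeries.coeff_succ_X_mul, PowerSeries.coeff_X]

theorem recip (U : Finset (Fin k)) : Rcp U.card (ES G U) (ET G U) := by
  induction U using Finset.strongInduction with
  | H U ih =>
  rcases U.eq_empty_or_nonempty with rfl | hU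
  · simpa using recip_empty G
  obtain ⟨u, hu⟩ : ∃ u, U.card = u + 1 := ⟨U.card - 1, by have := hU.card_pos; omega⟩
  rw [hu]
  have key : Rcp u
      (∑ W ∈ U.powerset.erase ∅, PowerSeries.C ((layerSets G U W).card : ℚ) * ES G (U \ W))
      (∑ W ∈ U.powerset.erase ∅, PowerSeries.C ((layerSets G U W).card : ℚ) *
        ((-1) ^ (W.card - 1) * ET G (U \ W))) := by
    refine Rcp.sum _ fun W hW => Rcp.smul _ ?_
    rw [Finset.mem_erase, Finset.mem_powerset] at hW
    have hWp : 0 < W.card := Finset.card_pos.2 (Finset.nonempty_iff_ne_empty.2 hW.1)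
    have hc := Finset.card_sdiff_add_card_eq_card hW.2
    have h1 := ih (U \ W) (Finset.sdiff_ssubset hW.2 (Finset.nonempty_iff_ne_empty.2 hW.1))
    have h2 := h1.lift (W.card - 1)
    rwa [show (U \ W).card + (W.card - 1) = u by omega] at h2
  have hmem : (∅ : Finset (Fin k)) ∈ U.powerset := by simp
  refine key.step ((layerSets G U U).card : ℚ) ?_ ?_
  · have := ES_rec G U
    rw [← Finset.add_sum_erase _ _ hmem, CC_empty, Finset.sdiff_empty] at this
    simp only [Nat.cast_one, map_one, one_mul] at this
    linear_combination this
  · have := ET_rec G U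
    rw [← Finset.add_sum_erase _ _ hmem, CC_empty, Finset.sdiff_empty, hu] at this
    simp only [Nat.cast_one, map_one, one_mul, Finset.card_empty, pow_zero] at this
    have h2 : ∑ W ∈ U.powerset.erase ∅,
        PowerSeries.C ((-1) ^ W.card * ((layerSets G U W).card : ℚ)) * ET G (U \ W) =
        - ∑ W ∈ U.powerset.erase ∅, PowerSeries.C ((layerSets G U W).card : ℚ) *
        ((-1) ^ (W.card - 1) * ET G (U \ W)) := by
      rw [← Finset.sum_neg_distrib]
      refine Finset.sum_congr rfl fun W hW => ?_
      rw [Finset.mem_erase, Finset.mem_powerset] at hW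
      have hWp : 0 < W.card := Finset.card_pos.2 (Finset.nonempty_iff_ne_empty.2 hW.1)
      obtain ⟨w, hw⟩ : ∃ w, W.card = w + 1 := ⟨W.card - 1, by omega⟩
      rw [hw]
      simp only [map_mul, map_pow, map_neg, map_one, Nat.add_sub_cancel]
      ring
    rw [h2] at this
    simp only [map_pow, map_neg, map_one] at this
    linear_combination -this

end Series

lemma ehr_eq {k : ℕ} (G : SimpleGraph (Fin k)) (n : ℕ) :
    ehr (graphPolytope G) n = (SS G Finset.univ n).card := by
  have hmem : ∀ m : Fin k → ℤ, ((fun i => (m i : ℝ)) ∈ (n : ℝ) • graphPolytope G) ↔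
      (∀ i, 0 ≤ m i ∧ m i ≤ n) ∧ ∀ i j, G.Adj i j → m i + m j ≤ n := by
    intro m
    rcases Nat.eq_zero_or_pos n with rfl | hn
    · have hne : (graphPolytope G).Nonempty := ⟨0, by simp [graphPolytope]⟩
      rw [Nat.cast_zero, Set.zero_smul_set hne]
      simp only [Set.mem_zero, funext_iff, Pi.zero_apply]
      constructor
      · intro h
        have h' : ∀ i, m i = 0 := fun i => by exact_mod_cast h i
        simp [h']
      · rintro ⟨h, -⟩ i
        have := h i
        have : m i = 0 := by push_cast at this; omega
        simp [this]
    · have hn' : (0 : ℝ) < n := by exact_mod_cast hn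
      rw [Set.mem_smul_set_iff_inv_smul_mem₀ hn'.ne']
      simp only [graphPolytope, Set.mem_ofPred_eq, Pi.smul_apply, smul_eq_mul, ← mul_add]
      have e1 : ∀ a : ℤ, 0 ≤ (n : ℝ)⁻¹ * a ↔ 0 ≤ a := by
        intro a
        rw [mul_nonneg_iff_of_pos_left (by positivity)]
        exact_mod_cast Iff.rfl
      have e2 : ∀ a : ℤ, (n : ℝ)⁻¹ * a ≤ 1 ↔ a ≤ n := by
        intro a
        rw [inv_mul_le_iff₀ hn', mul_one]
        exact_mod_cast Iff.rfl
      have e3 : ∀ a b : ℤ, (n : ℝ)⁻¹ * ((a : ℝ) + b) ≤ 1 ↔ a + b ≤ n := by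
        intro a b
        rw [← e2]; push_cast; rfl
      simp only [e1, e2, e3]
  rw [ehr]
  simp only [hmem]
  rw [← Set.ncard_coe_finset]
  symm
  refine Set.ncard_congr (fun y _ i => (y i : ℤ)) ?_ ?_ ?_
  · intro y hy
    rw [Finset.mem_coe, mem_SS] at hy
    refine ⟨fun i => ⟨by positivity, Nat.cast_le.2 (hy.1 i (by simp))⟩, fun i j hij => ?_⟩
    have := hy.2.2 i (by simp) j (by simp) hij
    dsimp only
    omega
  · intro a b _ _ h
    funext i
    exact_mod_cast congrFun h i
  · rintro m ⟨h1, h2⟩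
    refine ⟨fun i => (m i).toNat, ?_, ?_⟩
    · rw [Finset.mem_coe, mem_SS]
      refine ⟨fun i _ => ?_, fun i hi => by simp at hi, fun i _ j _ hij => ?_⟩
      · have := h1 i; omega
      · have := h1 i; have := h1 j; have := h2 i j hij; omega
    · funext i
      have := h1 i; simp only; omega

lemma ET_univ {k : ℕ} (hk : 2 ≤ k) (G : SimpleGraph (Fin k)) (hconn : G.Connected) :
    ET G Finset.univ = PowerSeries.X ^ 3 * ES G Finset.univ := by
  have hnb : ∀ i, ∃ j, G.Adj i j := by
    intro i
    have : Nontrivial (Fin k) := Fin.nontrivial_iff_two_le.2 hk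
    exact hconn.preconnected.exists_adj_of_nontrivial i
  have hsmall : ∀ n, n < 3 → (TT G Finset.univ n).card = 0 := by
    intro n hn
    rw [Finset.card_eq_zero, Finset.eq_empty_iff_forall_notMem]
    intro y hy
    rw [mem_TT] at hy
    obtain ⟨j, hj⟩ := hnb ⟨0, by omega⟩
    have h1 := hy.1 ⟨0, by omega⟩ (by simp)
    have h2 := hy.1 j (by simp)
    have h3 := hy.2.2 _ (by simp) _ (by simp) hj
    omega
  ext n
  rw [PowerSeries.coeff_X_pow_mul', ET, ES, PowerSeries.coeff_mk]
  by_cases hn : 3 ≤ n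
  · obtain ⟨m, rfl⟩ : ∃ m, n = m + 3 := ⟨n - 3, by omega⟩
    rw [if_neg (by omega), if_pos hn, PowerSeries.coeff_mk, Nat.add_sub_cancel]
    congr 1
    refine Finset.card_nbij' (fun y i => y i - 1) (fun y i => y i + 1) ?_ ?_ ?_ ?_
    · intro y hy
      rw [Finset.mem_coe, mem_TT] at hy
      rw [Finset.mem_coe, mem_SS]
      have h2 : ∀ i j, G.Adj i j → y i - 1 + (y j - 1) ≤ m := by
        intro i j hij
        have h1 := hy.1 i (by simp)
        have h2 := hy.1 j (by simp)
        have h3 := hy.2.2 _ (by simp) _ (by simp) hij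
        omega
      refine ⟨fun i _ => ?_, fun i hi => by simp at hi, fun i _ j _ hij => h2 i j hij⟩
      obtain ⟨j, hj⟩ := hnb i
      have := h2 i j hj
      simp only; omega
    · intro y hy
      rw [Finset.mem_coe, mem_SS] at hy
      rw [Finset.mem_coe, mem_TT]
      refine ⟨fun i _ => ?_, fun i hi => by simp at hi, fun i _ j _ hij => ?_⟩
      · have := hy.1 i (by simp)
        simp only; omega
      · have := hy.2.2 i (by simp) j (by simp) hij
        simp only; omega
    · intro y hy
      rw [Finset.mem_coe, mem_TT] at hy
      funext i
      have h1 := hy.1 i (by simp)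
      simp only; omega
    · intro y _
      funext i
      simp
  · rw [if_neg hn, hsmall n (by omega)]
    simp

theorem stmt0 {k : ℕ} (hk : 2 ≤ k) (G : SimpleGraph (Fin k)) (hconn : G.Connected)
    (s : ℕ) (hs : s ≤ k + 1) (H : Polynomial ℚ)
    (hH : ((1 - PowerSeries.X ^ 2) ^ s * (1 - PowerSeries.X) ^ (k + 1 - s) : PowerSeries ℚ) *
        ehrSeries (graphPolytope G) = (H : PowerSeries ℚ)) :
    H.natDegree = k + s - 2 ∧
      ∀ i ≤ k + s - 2, H.coeff i = H.coeff (k + s - 2 - i) := by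
  have hE : ehrSeries (graphPolytope G) = ES G Finset.univ := by
    ext n
    simp [ehrSeries, ES, ehr_eq]
  rw [hE] at hH
  have hH0 : H.coeff 0 = 1 := by
    have := congrArg (PowerSeries.coeff 0) hH
    rw [Polynomial.coeff_coe] at this
    rw [← this]
    simp [ES, SS_zero]
  obtain ⟨N, hN, h1, h2⟩ := recip G Finset.univ
  rw [Finset.card_univ, Fintype.card_fin] at hN h1 h2
  rw [ET_univ hk G hconn] at h2
  have h3 : N.reflect (2 * k + 1) = Polynomial.X ^ 3 * N := by
    apply Polynomial.coe_injective
    rw [← h2, Polynomial.coe_mul, ← h1]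
    simp only [Polynomial.coe_pow, Polynomial.coe_X]
    ring
  have hNd : N.natDegree ≤ 2 * k - 2 := by
    rw [Polynomial.natDegree_le_iff_coeff_eq_zero]
    intro m hm
    by_cases hm2 : 2 * k + 1 < m
    · exact Polynomial.coeff_eq_zero_of_natDegree_lt (by omega)
    · have := congrArg (fun p => Polynomial.coeff p (2 * k + 1 - m)) h3
      simp only [Polynomial.coeff_reflect, Polynomial.coeff_X_pow_mul'] at this
      rw [Polynomial.revAt_le (by omega), if_neg (by omega)] at this
      rwa [show 2 * k + 1 - (2 * k + 1 - m) = m by omega] at this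
  have hNr : N.reflect (2 * k - 2) = N := by
    have h4 : (1 * N).reflect (3 + (2 * k - 2)) = _ :=
      Polynomial.reflect_mul 1 N (F := 3) (by simp) hNd
    rw [one_mul, Polynomial.reflect_one, show 3 + (2 * k - 2) = 2 * k + 1 by omega, h3] at h4
    exact (mul_left_cancel₀ (pow_ne_zero 3 Polynomial.X_ne_zero) h4).symm
  set Q : ℚ[X] := (1 - Polynomial.X ^ 2) ^ s * (1 - Polynomial.X) ^ (k + 1 - s) with hQ
  have hQd : Q.natDegree ≤ k + s + 1 := by
    have := QQ_deg s (k + 1 - s)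
    rw [← hQ] at this
    omega
  have hQr : Q.reflect (k + s + 1) = (-1) ^ (k + 1) * Q := by
    have := QQ_reflect s (k + 1 - s)
    rwa [← hQ, show 2 * s + (k + 1 - s) = k + s + 1 by omega,
      show s + (k + 1 - s) = k + 1 by omega] at this
  have hHD : H * DD k = N * Q := by
    apply Polynomial.coe_injective
    rw [Polynomial.coe_mul, Polynomial.coe_mul, ← hH, ← h1, hQ]
    simp only [Polynomial.coe_mul, Polynomial.coe_sub, Polynomial.coe_one, Polynomial.coe_pow,
      Polynomial.coe_X]
    ring
  have hD0 : (DD k).coeff 0 = 1 := by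
    simp [DD, Polynomial.coeff_zero_eq_eval_zero]
  have hDne : DD k ≠ 0 := by
    intro h; rw [h] at hD0; simp at hD0
  have hHne : H ≠ 0 := by
    intro h; rw [h] at hH0; simp at hH0
  have hDdeg : (DD k).natDegree = 2 * k + 1 := by
    refine le_antisymm (DD_deg k) (Polynomial.le_natDegree_of_ne_zero ?_)
    have := congrArg (fun p => Polynomial.coeff p 0) (DD_reflect k)
    simp only [Polynomial.coeff_reflect, Polynomial.revAt_le (Nat.zero_le _), Nat.sub_zero] at this
    rw [this, Polynomial.mul_coeff_zero, hD0]
    simp [Polynomial.coeff_zero_eq_eval_zero]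
  have hHd : H.natDegree ≤ k + s - 2 := by
    have a1 := congrArg Polynomial.natDegree hHD
    rw [Polynomial.natDegree_mul hHne hDne, hDdeg] at a1
    have a2 := Polynomial.natDegree_mul_le (p := N) (q := Q)
    omega
  have hHr : H.reflect (k + s - 2) = H := by
    have a1 := Polynomial.reflect_mul H (DD k) hHd (DD_deg k)
    have a2 := Polynomial.reflect_mul N Q hNd hQd
    rw [show k + s - 2 + (2 * k + 1) = 2 * k - 2 + (k + s + 1) by omega, hHD, a2, hNr, hQr,
      DD_reflect] at a1
    have hu : ((-1 : ℚ[X]) ^ (k + 1)) ≠ 0 := pow_ne_zero _ (by simp)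
    apply mul_right_cancel₀ hDne
    apply mul_left_cancel₀ hu
    rw [hHD]
    linear_combination -a1
  have hpal : ∀ i ≤ k + s - 2, H.coeff i = H.coeff (k + s - 2 - i) := by
    intro i hi
    conv_lhs => rw [← hHr]
    rw [Polynomial.coeff_reflect, Polynomial.revAt_le hi]
  refine ⟨le_antisymm hHd (Polynomial.le_natDegree_of_ne_zero ?_), hpal⟩
  have := hpal 0 (Nat.zero_le _)
  rw [Nat.sub_zero, hH0] at this
  rw [← this]
  exact one_ne_zero
end

section
/- Let G=(V,E) be a finite simple connected bipartite graph with vertex set V={v_1,…,v_k}, k ≥ 2. Then there exists a polynomial H(x) with nonnegative integer coefficients such that (1−x)^{k+1} · Ehr(P(G),x) = H(x) as formal power series, and H is palindromic of degree exactly k−2. -/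
open Polynomial PowerSeries Pointwise

def chainSet (m : ℕ) (d : Fin m → ℕ) (n : ℕ) : Finset (Fin (m+1) → ℕ) :=
  (Fintype.piFinset fun _ => Finset.range (n+1)).filter
    (fun g => ∀ i : Fin m, g i.castSucc + d i ≤ g i.succ)

lemma mem_chainSet {m : ℕ} {d : Fin m → ℕ} {n : ℕ} {g : Fin (m+1) → ℕ} :
    g ∈ chainSet m d n ↔ g (Fin.last m) ≤ n ∧ ∀ i : Fin m, g i.castSucc + d i ≤ g i.succ := by
  simp only [chainSet, Finset.mem_filter, Fintype.mem_piFinset, Finset.mem_range, Nat.lt_succ_iff]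
  constructor
  · rintro ⟨h1, h2⟩
    exact ⟨h1 _, h2⟩
  · rintro ⟨h1, h2⟩
    refine ⟨fun i => ?_, h2⟩
    have : Monotone g := Fin.monotone_iff_le_succ.2 fun i => by have := h2 i; omega
    exact (this (Fin.le_last i)).trans h1

lemma chain_top (m : ℕ) (d : Fin (m+1) → ℕ) (n : ℕ) :
    ((chainSet (m+1) d n).filter (fun g => g (Fin.last (m+1)) = n)).card =
      if d (Fin.last m) ≤ n then (chainSet m (fun i => d i.castSucc) (n - d (Fin.last m))).card
      else 0 := by
  split_ifs with h
  · refine Finset.card_bij' (fun g _ => Fin.init g) (fun g _ => Fin.snoc (α := fun _ => ℕ) g n) ?_ ?_ ?_ ?_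
    · intro g hg
      simp only [Finset.mem_filter, mem_chainSet] at hg ⊢
      obtain ⟨⟨h1, h2⟩, h3⟩ := hg
      refine ⟨?_, fun i => ?_⟩
      · have := h2 (Fin.last m)
        rw [Fin.succ_last] at this
        simp only [Fin.init, Nat.succ_eq_add_one] at *
        omega
      · exact h2 i.castSucc
    · intro g hg
      simp only [Finset.mem_filter, mem_chainSet] at hg ⊢
      obtain ⟨h1, h2⟩ := hg
      refine ⟨⟨by simp, fun i => ?_⟩, by simp⟩
      refine Fin.lastCases ?_ (fun i => ?_) i
      · rw [Fin.succ_last, Fin.snoc_last, Fin.snoc_castSucc]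
        omega
      · rw [Fin.succ_castSucc, Fin.snoc_castSucc, Fin.snoc_castSucc]
        exact h2 i
    · intro g hg
      simp only [Finset.mem_filter, mem_chainSet] at hg
      have := Fin.snoc_init_self g
      rw [hg.2] at this
      exact this
    · intro g hg
      exact Fin.init_snoc (α := fun _ => ℕ) _ _
  · rw [Finset.card_eq_zero, Finset.filter_eq_empty_iff]
    intro g hg h3
    rw [mem_chainSet] at hg
    have := hg.2 (Fin.last m)
    rw [Fin.succ_last] at this
    simp only [Nat.succ_eq_add_one] at *
    omega

lemma chain_succ (m : ℕ) (d : Fin m → ℕ) (n : ℕ) :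
    (chainSet m d (n+1)).card = (chainSet m d n).card +
      ((chainSet m d (n+1)).filter (fun g => g (Fin.last m) = n+1)).card := by
  rw [← Finset.card_filter_add_card_filter_not (s := chainSet m d (n+1)) (fun g => g (Fin.last m) = n+1), add_comm]
  congr 2
  ext g
  simp only [Finset.mem_filter, mem_chainSet]
  grind

lemma chain_zero (m : ℕ) (d : Fin m → ℕ) :
    (chainSet m d 0).card = 
      ((chainSet m d 0).filter (fun g => g (Fin.last m) = 0)).card := by
  congr 1
  ext g
  simp only [Finset.mem_filter, mem_chainSet]
  grind

noncomputable def chainSer (m : ℕ) (d : Fin m → ℕ) : PowerSeries ℚ :=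
  PowerSeries.mk fun n => ((chainSet m d n).card : ℚ)

lemma one_sub_X_mul_chain (m : ℕ) (d : Fin m → ℕ) :
    (1 - PowerSeries.X) * chainSer m d = PowerSeries.mk fun n =>
     (((chainSet m d n).filter (fun g => g (Fin.last m) = n)).card : ℚ) := by
  ext n
  rw [sub_mul, one_mul, map_sub]
  cases n with
  | zero => simp [chainSer, ← chain_zero]
  | succ n =>
    rw [PowerSeries.coeff_succ_X_mul]
    simp only [chainSer, PowerSeries.coeff_mk]
    rw [chain_succ]
    push_cast
    ring

lemma chain_series (m : ℕ) (d : Fin m → ℕ) :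
    (1 - PowerSeries.X : PowerSeries ℚ) ^ (m+2) * chainSer m d = PowerSeries.X ^ (∑ i, d i) := by
  induction m with
  | zero =>
    rw [pow_succ, mul_assoc, one_sub_X_mul_chain]
    have : ∀ n, ((chainSet 0 d n).filter (fun g => g (Fin.last 0) = n)).card = 1 := by
      intro n
      rw [Finset.card_eq_one]
      refine ⟨fun _ => n, ?_⟩
      ext g
      simp only [Finset.mem_filter, mem_chainSet, Finset.mem_singleton, funext_iff]
      simp
      grind
    simp only [this]
    ext n
    rw [pow_one, sub_mul, one_mul, map_sub]
    cases n with
    | zero => simp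
    | succ n => rw [PowerSeries.coeff_succ_X_mul]; simp [PowerSeries.coeff_one]
  | succ m ih =>
    rw [pow_succ, mul_assoc, one_sub_X_mul_chain]
    have : (PowerSeries.mk fun n =>
     (((chainSet (m+1) d n).filter (fun g => g (Fin.last (m+1)) = n)).card : ℚ)) =
      PowerSeries.X ^ (d (Fin.last m)) * chainSer m (fun i => d i.castSucc) := by
      ext n
      rw [PowerSeries.coeff_X_pow_mul', PowerSeries.coeff_mk, chain_top]
      split_ifs <;> simp [chainSer]
    rw [this, mul_left_comm, ih, Fin.sum_univ_castSucc, ← pow_add, add_comm]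

/-- tie-broken descent indicator -/
def dsc {m : ℕ} (ρ σ : Equiv.Perm (Fin (m+1))) (i : Fin m) : ℕ :=
  if ρ.symm (σ i.castSucc) < ρ.symm (σ i.succ) then 0 else 1

lemma sort_lex {m : ℕ} (ρ σ : Equiv.Perm (Fin (m+1))) (f : Fin (m+1) → ℕ) :
    ρ * Tuple.sort (f ∘ ρ) = σ ↔
      StrictMono (fun i => toLex (f (σ i), ρ.symm (σ i))) := by
  have h0 : ρ * Tuple.sort (f ∘ ρ) = σ ↔ ρ⁻¹ * σ = Tuple.sort (f ∘ ρ) := by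
    rw [inv_mul_eq_iff_eq_mul, eq_comm]
  have h1 : ρ⁻¹ * σ = Tuple.sort (f ∘ ρ) ↔
      StrictMono (fun i => toLex (f (σ i), ρ.symm (σ i))) := by
    rw [Tuple.eq_sort_iff]
    constructor
    · rintro ⟨h2, h3⟩ i j hij
      have a := h2 hij.le
      have b := h3 i j hij
      simp [Equiv.Perm.inv_def] at a b
      rw [Prod.Lex.toLex_lt_toLex]
      simp only
      rcases a.lt_or_eq with a | a
      · exact Or.inl a
      · exact Or.inr ⟨a, b a⟩
    · intro h
      refine ⟨fun i j hij => ?_, fun i j hij => ?_⟩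
      · have := h.monotone hij
        simp only [Prod.Lex.toLex_le_toLex] at this
        simp [Equiv.Perm.inv_def]
        grind
      · have := h hij
        simp only [Prod.Lex.toLex_lt_toLex] at this
        simp [Equiv.Perm.inv_def]
        grind
  rw [h0, h1]

lemma sort_iff {m : ℕ} (ρ σ : Equiv.Perm (Fin (m+1))) (f : Fin (m+1) → ℕ) :
    ρ * Tuple.sort (f ∘ ρ) = σ ↔
      ∀ i : Fin m, f (σ i.castSucc) + dsc ρ σ i ≤ f (σ i.succ) := by
  rw [sort_lex, Fin.strictMono_iff_lt_succ]
  refine forall_congr' fun i => ?_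
  rw [Prod.Lex.toLex_lt_toLex, dsc]
  simp only
  split_ifs <;> grind

def boxSet (k n : ℕ) : Finset (Fin k → ℕ) := Fintype.piFinset fun _ => Finset.range (n+1)

lemma mem_boxSet {k n : ℕ} {f : Fin k → ℕ} : f ∈ boxSet k n ↔ ∀ i, f i ≤ n := by
  simp [boxSet]

lemma card_fiber {m : ℕ} (ρ σ : Equiv.Perm (Fin (m+1))) (n : ℕ) :
    ((boxSet (m+1) n).filter (fun f => ρ * Tuple.sort (f ∘ ρ) = σ)).card =
      (chainSet m (dsc ρ σ) n).card := by
  refine Finset.card_bij' (fun f _ => f ∘ σ) (fun g _ => g ∘ σ.symm) ?_ ?_ ?_ ?_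
  · intro f hf
    rw [Finset.mem_filter, mem_boxSet, sort_iff] at hf
    rw [mem_chainSet]
    exact ⟨hf.1 _, hf.2⟩
  · intro g hg
    rw [Finset.mem_filter, mem_boxSet, sort_iff]
    refine ⟨fun i => ?_, fun i => ?_⟩
    · simp only [chainSet, Finset.mem_filter, Fintype.mem_piFinset, Finset.mem_range] at hg
      exact Nat.lt_succ_iff.1 (hg.1 _)
    · rw [mem_chainSet] at hg
      simpa using hg.2 i
  · intro f _
    ext; simp
  · intro f _
    ext; simp

lemma master {m : ℕ} (ρ : Equiv.Perm (Fin (m+1))) (L : Finset (Equiv.Perm (Fin (m+1))))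
    (Q : (Fin (m+1) → ℕ) → Prop) [DecidablePred Q]
    (hQ : ∀ f, Q f ↔ ρ * Tuple.sort (f ∘ ρ) ∈ L) :
    (1 - PowerSeries.X : PowerSeries ℚ) ^ (m+2) *
      (PowerSeries.mk fun n => (((boxSet (m+1) n).filter Q).card : ℚ)) =
      ∑ σ ∈ L, PowerSeries.X ^ (∑ i, dsc ρ σ i) := by
  have : (PowerSeries.mk fun n => (((boxSet (m+1) n).filter Q).card : ℚ)) =
      ∑ σ ∈ L, chainSer m (dsc ρ σ) := by
    ext n
    rw [map_sum]
    simp only [chainSer, PowerSeries.coeff_mk]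
    rw [Finset.card_eq_sum_card_fiberwise (t := L) (f := fun f => ρ * Tuple.sort (f ∘ ρ))]
    · push_cast
      refine Finset.sum_congr rfl fun σ hσ => ?_
      rw [← card_fiber]
      congr 2
      ext f
      simp only [Finset.mem_filter, hQ]
      grind
    · intro f hf
      have := (Finset.mem_filter.1 hf).2
      exact (hQ f).1 this
  rw [this, Finset.mul_sum]
  exact Finset.sum_congr rfl fun σ _ => chain_series _ _

lemma sort_lt {m : ℕ} (ρ : Equiv.Perm (Fin (m+1))) (f : Fin (m+1) → ℕ) (u v : Fin (m+1)) :
    (ρ * Tuple.sort (f ∘ ρ)).symm u < (ρ * Tuple.sort (f ∘ ρ)).symm v ↔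
      f u < f v ∨ (f u = f v ∧ ρ.symm u < ρ.symm v) := by
  have h := (sort_lex ρ _ f).1 rfl
  rw [← h.lt_iff_lt, Prod.Lex.toLex_lt_toLex]
  simp only [Equiv.apply_symm_apply]

open Classical in
/-- linear extensions -/
noncomputable def linExt {m : ℕ} (R : Fin (m+1) → Fin (m+1) → Prop) :
    Finset (Equiv.Perm (Fin (m+1))) :=
  Finset.univ.filter fun σ => ∀ i j, R i j → σ.symm i < σ.symm j

lemma weak_iff {m : ℕ} {R : Fin (m+1) → Fin (m+1) → Prop} (hR : ∀ i j, R i j → i < j)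
    (f : Fin (m+1) → ℕ) : (∀ i j, R i j → f i ≤ f j) ↔
      (1 : Equiv.Perm (Fin (m+1))) * Tuple.sort (f ∘ (1 : Equiv.Perm (Fin (m+1)))) ∈ linExt R := by
  simp only [linExt, Finset.mem_filter, Finset.mem_univ, true_and, sort_lt]
  refine forall_congr' fun i => forall_congr' fun j => forall_congr' fun h => ?_
  have := hR i j h
  have h2 : (Equiv.symm (1 : Equiv.Perm (Fin (m+1)))) i < (Equiv.symm (1 : Equiv.Perm (Fin (m+1)))) j := this
  grind

lemma strict_iff {m : ℕ} {R : Fin (m+1) → Fin (m+1) → Prop} (hR : ∀ i j, R i j → i < j)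
    (f : Fin (m+1) → ℕ) : (∀ i j, R i j → f i < f j) ↔
      (Fin.revPerm : Equiv.Perm (Fin (m+1))) * Tuple.sort (f ∘ (Fin.revPerm : Equiv.Perm (Fin (m+1))))
        ∈ linExt R := by
  simp only [linExt, Finset.mem_filter, Finset.mem_univ, true_and, sort_lt]
  refine forall_congr' fun i => forall_congr' fun j => forall_congr' fun h => ?_
  have := hR i j h
  have h2 : ¬ ((Equiv.symm (Fin.revPerm : Equiv.Perm (Fin (m+1)))) i <
    (Equiv.symm (Fin.revPerm : Equiv.Perm (Fin (m+1)))) j) := by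
    simp [Fin.revPerm_symm]
    exact this.le
  grind

lemma dsc_rev {m : ℕ} (σ : Equiv.Perm (Fin (m+1))) (i : Fin m) :
    dsc Fin.revPerm σ i + dsc 1 σ i = 1 := by
  have h : σ i.castSucc ≠ σ i.succ := fun h => by
    have := σ.injective h
    exact absurd this (Fin.castSucc_lt_succ (i := i)).ne
  have h2 : (Equiv.symm (1 : Equiv.Perm (Fin (m+1)))) = 1 := rfl
  simp only [dsc, Fin.revPerm_symm, Fin.revPerm_apply, Fin.rev_lt_rev, h2, Equiv.Perm.one_apply]
  split_ifs <;> first | rfl | (exfalso; grind)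

lemma sum_dsc_rev {m : ℕ} (σ : Equiv.Perm (Fin (m+1))) :
    ∑ i, dsc Fin.revPerm σ i + ∑ i, dsc 1 σ i = m := by
  rw [← Finset.sum_add_distrib]
  simp [dsc_rev]

open Classical in
noncomputable def weakCard {m : ℕ} (R : Fin (m+1) → Fin (m+1) → Prop) (n : ℕ) : ℕ :=
  ((boxSet (m+1) n).filter fun f => ∀ i j, R i j → f i ≤ f j).card

open Classical in
noncomputable def strictCard {m : ℕ} (R : Fin (m+1) → Fin (m+1) → Prop) (n : ℕ) : ℕ :=
  ((boxSet (m+1) n).filter fun f => ∀ i j, R i j → f i < f j).card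

lemma core {m : ℕ} (hm : 1 ≤ m) {R : Fin (m+1) → Fin (m+1) → Prop} (hR : ∀ i j, R i j → i < j)
    (h0 : strictCard R 0 = 0) (hs : ∀ n, strictCard R (n+1) = weakCard R n) :
    ∃ H : Polynomial ℕ,
      ((1 - PowerSeries.X) ^ (m + 2) : PowerSeries ℚ) *
        (PowerSeries.mk fun n => (weakCard R n : ℚ)) =
          ((H.map (Nat.castRingHom ℚ) : Polynomial ℚ) : PowerSeries ℚ) ∧
        H.natDegree = m - 1 ∧
        ∀ i ≤ m - 1, H.coeff i = H.coeff (m - 1 - i) := by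
  classical
  set H : Polynomial ℕ := ∑ σ ∈ linExt R, Polynomial.X ^ (∑ i, dsc 1 σ i) with hH
  set K : Polynomial ℕ := ∑ σ ∈ linExt R, Polynomial.X ^ (∑ i, dsc Fin.revPerm σ i) with hK
  have e1 : ((1 - PowerSeries.X) ^ (m + 2) : PowerSeries ℚ) *
        (PowerSeries.mk fun n => (weakCard R n : ℚ)) =
          ((H.map (Nat.castRingHom ℚ) : Polynomial ℚ) : PowerSeries ℚ) := by
    have := master 1 (linExt R) _ (weak_iff hR)
    rw [hH, Polynomial.map_sum, ← Polynomial.coeToPowerSeries.ringHom_apply, map_sum]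
    simp only [Polynomial.map_pow, Polynomial.map_X, map_pow,
      Polynomial.coeToPowerSeries.ringHom_apply, Polynomial.coe_X]
    rw [← this]
    rfl
  have e2 : ((1 - PowerSeries.X) ^ (m + 2) : PowerSeries ℚ) *
        (PowerSeries.mk fun n => (strictCard R n : ℚ)) =
          ((K.map (Nat.castRingHom ℚ) : Polynomial ℚ) : PowerSeries ℚ) := by
    have := master Fin.revPerm (linExt R) _ (strict_iff hR)
    rw [hK, Polynomial.map_sum, ← Polynomial.coeToPowerSeries.ringHom_apply, map_sum]
    simp only [Polynomial.map_pow, Polynomial.map_X, map_pow,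
      Polynomial.coeToPowerSeries.ringHom_apply, Polynomial.coe_X]
    rw [← this]
    rfl
  have e3 : (PowerSeries.mk fun n => (strictCard R n : ℚ)) =
      PowerSeries.X * (PowerSeries.mk fun n => (weakCard R n : ℚ)) := by
    ext n
    cases n with
    | zero => simp [h0]
    | succ n => rw [PowerSeries.coeff_succ_X_mul]; simp [hs]
  rw [e3, mul_left_comm, e1] at e2
  have e4 : K = Polynomial.X * H := by
    apply Polynomial.map_injective (Nat.castRingHom ℚ) Nat.cast_injective
    apply Polynomial.coe_injective ℚ
    rw [← e2, Polynomial.map_mul, Polynomial.map_X, Polynomial.coe_mul, Polynomial.coe_X]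
  have cH : ∀ j, H.coeff j = ((linExt R).filter fun σ => ∑ i, dsc 1 σ i = j).card := by
    intro j
    rw [hH, Polynomial.finsetSum_coeff, Finset.card_filter]
    simp only [Polynomial.coeff_X_pow, eq_comm]
  have cK : ∀ j, K.coeff j = ((linExt R).filter fun σ => ∑ i, dsc Fin.revPerm σ i = j).card := by
    intro j
    rw [hK, Polynomial.finsetSum_coeff, Finset.card_filter]
    simp only [Polynomial.coeff_X_pow, eq_comm]
  have cHK : ∀ j ≤ m, H.coeff j = K.coeff (m - j) := by
    intro j hj
    rw [cH, cK]
    congr 1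
    ext σ
    have := sum_dsc_rev σ
    simp only [Finset.mem_filter]
    grind
  have big : ∀ j, m < j → H.coeff j = 0 := by
    intro j hj
    rw [cH, Finset.card_eq_zero, Finset.filter_eq_empty_iff]
    intro σ _
    have := sum_dsc_rev σ
    omega
  have hm' : H.coeff m = 0 := by
    rw [cHK m le_rfl, e4]; simp
  have sym : ∀ i ≤ m - 1, H.coeff i = H.coeff (m - 1 - i) := by
    intro i hi
    rw [cHK i (by omega), e4, show m - i = (m - 1 - i) + 1 by omega, Polynomial.coeff_X_mul]
  have c0 : H.coeff 0 ≠ 0 := by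
    rw [cH, Finset.card_ne_zero]
    refine ⟨1, ?_⟩
    simp only [Finset.mem_filter, linExt, Finset.mem_univ, true_and]
    refine ⟨hR, ?_⟩
    apply Finset.sum_eq_zero
    intro i _
    rw [dsc, if_pos]
    exact Fin.castSucc_lt_succ
  refine ⟨H, e1, ?_, sym⟩
  apply le_antisymm
  · rw [Polynomial.natDegree_le_iff_coeff_eq_zero]
    intro N hN
    rcases (show m ≤ N by omega).eq_or_lt with h | h
    · rw [← h, hm']
    · exact big _ h
  · apply Polynomial.le_natDegree_of_ne_zero
    rw [sym _ le_rfl]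
    simpa using c0

lemma mem_smul_polytope {V : Type*} (G : SimpleGraph V) (n : ℕ) (x : V → ℤ) :
    (fun i => (x i : ℝ)) ∈ (n : ℝ) • graphPolytope G ↔
      (∀ i, 0 ≤ x i ∧ x i ≤ n) ∧ ∀ i j, G.Adj i j → x i + x j ≤ n := by
  rcases Nat.eq_zero_or_pos n with rfl | hn
  · have hne : (graphPolytope G).Nonempty := ⟨0, by simp [graphPolytope]⟩
    rw [Nat.cast_zero, Set.zero_smul_set hne]
    constructor
    · intro h
      have : ∀ i, x i = 0 := fun i => by
        have := congrFun (Set.mem_zero.1 h) i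
        simpa using this
      simp [this]
    · rintro ⟨h, -⟩
      rw [Set.mem_zero]
      ext i
      have := h i
      have : x i = 0 := by push_cast at this; omega
      simp [this]
  · have hn' : (0 : ℝ) < n := by exact_mod_cast hn
    rw [Set.mem_smul_set_iff_inv_smul_mem₀ hn'.ne']
    simp only [graphPolytope, Set.mem_setOf_eq, Pi.smul_apply, smul_eq_mul]
    refine and_congr (forall_congr' fun i => and_congr ?_ ?_)
      (forall_congr' fun i => forall_congr' fun j => forall_congr' fun _ => ?_)
    · rw [mul_nonneg_iff_of_pos_left (by positivity)]
      exact_mod_cast Iff.rfl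
    · rw [inv_mul_le_iff₀ hn', mul_one]
      exact_mod_cast Iff.rfl
    · rw [← mul_add, inv_mul_le_iff₀ hn', mul_one]
      exact_mod_cast Iff.rfl

theorem stmt1 {k : ℕ} (hk : 2 ≤ k) (G : SimpleGraph (Fin k)) (hconn : G.Connected)
    (hbip : G.Colorable 2) :
    ∃ H : Polynomial ℕ,
      ((1 - PowerSeries.X) ^ (k + 1) : PowerSeries ℚ) * ehrSeries (graphPolytope G) =
          ((H.map (Nat.castRingHom ℚ) : Polynomial ℚ) : PowerSeries ℚ) ∧
        H.natDegree = k - 2 ∧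
        ∀ i ≤ k - 2, H.coeff i = H.coeff (k - 2 - i) := by
  classical
  obtain ⟨m, rfl⟩ : ∃ m, k = m + 1 := ⟨k - 1, by omega⟩
  obtain ⟨C⟩ := hbip
  have hC : ∀ i j, G.Adj i j → C i ≠ C j := fun i j h => C.valid h
  set c : Fin (m+1) → Fin 2 := fun i => C i with hc
  set e : Equiv.Perm (Fin (m+1)) := Tuple.sort c with he
  have hmono : Monotone (c ∘ e) := Tuple.monotone_sort c
  have hnb : ∀ i, ∃ j, G.Adj i j := by
    have : Nontrivial (Fin (m+1)) := Fin.nontrivial_iff_two_le.2 hk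
    exact fun i => hconn.preconnected.exists_adj_of_nontrivial i
  obtain ⟨R, hRiff⟩ : ∃ R : Fin (m+1) → Fin (m+1) → Prop,
      ∀ i j, R i j ↔ G.Adj (e i) (e j) ∧ i < j := ⟨_, fun _ _ => Iff.rfl⟩
  have hR : ∀ i j, R i j → i < j := fun i j h => ((hRiff _ _).1 h).2
  have hRc : ∀ i j, R i j → c (e i) = 0 ∧ c (e j) = 1 := by
    intro i j h
    rw [hRiff] at h
    have h1 := hmono h.2.le
    have h2 := hC _ _ h.1
    simp only [Function.comp] at h1
    simp only [hc] at *
    omega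
  have hR' : ∀ i j, G.Adj (e i) (e j) → c (e i) = 0 → R i j := by
    intro i j h h0
    refine (hRiff _ _).2 ⟨h, ?_⟩
    by_contra hlt
    have h1 := hmono (not_lt.1 hlt)
    have h2 := hC _ _ h
    simp only [Function.comp] at h1
    simp only [hc] at *
    omega
  have c2 : ∀ i, c i = 0 ∨ c i = 1 := fun i => by omega
  have hup : ∀ i, c (e i) = 0 → ∃ j, R i j := by
    intro i hi
    obtain ⟨j, hj⟩ := hnb (e i)
    exact ⟨e.symm j, hR' _ _ (by simpa using hj) hi⟩
  have hdown : ∀ i, c (e i) = 1 → ∃ j, R j i := by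
    intro i hi
    obtain ⟨j, hj⟩ := hnb (e i)
    refine ⟨e.symm j, hR' _ _ (by simpa using hj.symm) ?_⟩
    have := hC _ _ hj
    simp only [Equiv.apply_symm_apply]
    simp only [hc] at *
    omega
  have hs0 : strictCard R 0 = 0 := by
    rw [strictCard, Finset.card_eq_zero, Finset.filter_eq_empty_iff]
    intro f hf h
    rw [mem_boxSet] at hf
    have : ∃ i j, R i j := by
      rcases c2 (e 0) with h | h
      · exact ⟨0, hup 0 h⟩
      · obtain ⟨j, hj⟩ := hdown 0 h
        exact ⟨j, 0, hj⟩
    obtain ⟨i, j, hij⟩ := this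
    have := h i j hij
    have := hf j
    omega
  have hs : ∀ n, strictCard R (n+1) = weakCard R n := by
    intro n
    refine Finset.card_bij' (fun f _ i => if c (e i) = 0 then f i else f i - 1)
      (fun f _ i => if c (e i) = 0 then f i else f i + 1) ?_ ?_ ?_ ?_
    · intro f hf
      rw [Finset.mem_filter, mem_boxSet] at hf ⊢
      refine ⟨fun i => ?_, fun i j hij => ?_⟩
      · have h1 := hf.1 i
        split_ifs with h
        · obtain ⟨j, hj⟩ := hup i h
          have := hf.2 i j hj
          have := hf.1 j
          omega
        · omega
      · have := hf.2 i j hij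
        obtain ⟨h1, h2⟩ := hRc i j hij
        simp only [h1, h2, if_true, one_ne_zero, if_false]
        omega
    · intro f hf
      rw [Finset.mem_filter, mem_boxSet] at hf ⊢
      refine ⟨fun i => ?_, fun i j hij => ?_⟩
      · have h1 := hf.1 i
        split_ifs with h <;> omega
      · have := hf.2 i j hij
        obtain ⟨h1, h2⟩ := hRc i j hij
        simp only [h1, h2, if_true, one_ne_zero, if_false]
        omega
    · intro f hf
      rw [Finset.mem_filter, mem_boxSet] at hf
      funext i
      dsimp only
      split_ifs with h
      · rfl
      · obtain ⟨j, hj⟩ := hdown i ((c2 _).resolve_left h)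
        have := hf.2 j i hj
        omega
    · intro f hf
      funext i
      dsimp only
      split_ifs with h
      · rfl
      · omega
  have hehr : ∀ n, ehr (graphPolytope G) n = weakCard R n := by
    intro n
    rw [ehr, weakCard, ← Set.ncard_coe_finset]
    simp only [mem_smul_polytope]
    refine Set.ncard_congr
      (fun x _ i => if c (e i) = 0 then (x (e i)).toNat else ((n : ℤ) - x (e i)).toNat) ?_ ?_ ?_
    · rintro x ⟨h1, h2⟩
      rw [Finset.mem_coe, Finset.mem_filter, mem_boxSet]
      refine ⟨fun i => ?_, fun i j hij => ?_⟩
      · have := h1 (e i)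
        split_ifs <;> omega
      · have h5 := h2 _ _ ((hRiff _ _).1 hij).1
        obtain ⟨h3, h4⟩ := hRc i j hij
        simp only [h3, h4, if_true, one_ne_zero, if_false]
        have := h1 (e i)
        have := h1 (e j)
        omega
    · rintro x y ⟨hx, -⟩ ⟨hy, -⟩ hxy
      funext v
      have := congrFun hxy (e.symm v)
      simp only [Equiv.apply_symm_apply] at this
      have := hx v
      have := hy v
      split_ifs at * <;> omega
    · intro f hf
      rw [Finset.mem_coe, Finset.mem_filter, mem_boxSet] at hf
      obtain ⟨h1, h2⟩ := hf
      refine ⟨fun v => if c v = 0 then (f (e.symm v) : ℤ) else (n : ℤ) - f (e.symm v), ⟨?_, ?_⟩, ?_⟩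
      · intro v
        have := h1 (e.symm v)
        dsimp only
        split_ifs <;> omega
      · have key : ∀ u v, G.Adj u v → c u = 0 → c v = 1 ∧ f (e.symm u) ≤ f (e.symm v) := by
          intro u v huv hu
          have hr : R (e.symm u) (e.symm v) := hR' _ _ (by simpa using huv) (by simpa using hu)
          refine ⟨?_, h2 _ _ hr⟩
          simpa using (hRc _ _ hr).2
        intro u v huv
        rcases c2 u with hu | hu
        · obtain ⟨a, b⟩ := key u v huv hu
          simp only [hu, a, if_true, one_ne_zero, if_false]
          omega
        · have hv : c v = 0 := by
            have := hC _ _ huv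
            simp only [hc] at *
            omega
          obtain ⟨a, b⟩ := key v u huv.symm hv
          simp only [hu, hv, if_true, one_ne_zero, if_false]
          omega
      · funext i
        have := h1 i
        simp only [Equiv.symm_apply_apply]
        split_ifs <;> omega
  have hser : ehrSeries (graphPolytope G) = PowerSeries.mk fun n => (weakCard R n : ℚ) := by
    simp only [ehrSeries, hehr]
  rw [hser]
  exact core (by omega) hR hs0 hs
end

section
/- Let H=(V,E*) be a finite simple connected s-uniform hypergraph with V={v_1,…,v_k} and E*=(e_1,…,e_r) satisfying e_1 ∪ … ∪ e_r = V. Suppose M(x) and Q(x) are coprime polynomials with rational coefficients, Q(0) = 1, and M(x)/Q(x) has power series expansion equal to the Ehrhart series Ehr(P(H),x). Then M is palindromic of degree exactly deg Q − (s+1), i.e. x^{deg Q − s − 1}·M(1/x) = M(x). -/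
open Polynomial PowerSeries Pointwise

/-- The hypergraph polytope `P(H)` of a hypergraph with vertex set `Fin k` and
hyperedges `E 1, …, E r`: all nonnegative points with `Σ_{j ∈ e} x j ≤ 1` for
every hyperedge `e`. -/
def hypergraphPolytope {k r : ℕ} (E : Fin r → Finset (Fin k)) : Set (Fin k → ℝ) :=
  {x | (∀ i, 0 ≤ x i) ∧ ∀ i : Fin r, ∑ j ∈ E i, x j ≤ 1}

/-- A hypergraph is simple if no hyperedge is contained in another (distinct) one. -/
def HypSimple {k r : ℕ} (E : Fin r → Finset (Fin k)) : Prop :=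
  ∀ i j, E i ⊆ E j → i = j

/-- A hypergraph is connected if any two vertices are joined by a path of hyperedges:
the reflexive-transitive closure of "lie in a common hyperedge" relates all pairs. -/
def HypConnected {k r : ℕ} (E : Fin r → Finset (Fin k)) : Prop :=
  ∀ u v : Fin k, Relation.ReflTransGen (fun a b => ∃ i, a ∈ E i ∧ b ∈ E i) u v

/-- The incidence matrix of a hypergraph: `A i j = 1` iff vertex `j` lies in hyperedge `i`. -/
def incidenceMatrix {k r : ℕ} (E : Fin r → Finset (Fin k)) : Matrix (Fin r) (Fin k) ℚ :=
  Matrix.of fun i j => if j ∈ E i then 1 else 0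

/-- A matrix is totally unimodular if every square submatrix has determinant `-1`, `0` or `1`. -/
def TotUnimodular {r k : ℕ} (A : Matrix (Fin r) (Fin k) ℚ) : Prop :=
  ∀ (n : ℕ) (f : Fin n → Fin r) (g : Fin n → Fin k),
    Function.Injective f → Function.Injective g →
      (A.submatrix f g).det = -1 ∨ (A.submatrix f g).det = 0 ∨ (A.submatrix f g).det = 1

set_option linter.all false

namespace HypEhr

variable {ι : Type} [Fintype ι] [DecidableEq ι]

def dot {R : Type} [CommRing R] (c : ι → ℤ) (α : ι → R) : R := ∑ l, (c l : R) * α l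

def TT (i j : ι) (c : ι → ℤ) : ι → ℤ := c + Pi.single j (c i)

def UU {R : Type} [CommRing R] (i j : ι) (α : ι → R) : ι → R := α + Pi.single i (α j)

def VV {R : Type} [CommRing R] (i j : ι) (α : ι → R) : ι → R := α - Pi.single i (α j)

theorem UU_VV {R : Type} [CommRing R] {i j : ι} (h : i ≠ j) (α : ι → R) : UU i j (VV i j α) = α := by
  funext l
  simp [UU, VV, Pi.single_apply, h.symm]

theorem VV_UU {R : Type} [CommRing R] {i j : ι} (h : i ≠ j) (α : ι → R) : VV i j (UU i j α) = α := by
  funext l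
  simp [UU, VV, Pi.single_apply, h.symm]

theorem dot_TT {R : Type} [CommRing R] {i j : ι} (h : i ≠ j) (c : ι → ℤ) (β : ι → R) :
    dot (TT i j c) β = dot c (UU i j β) := by
  unfold dot TT UU
  simp only [Pi.add_apply, Int.cast_add, add_mul, mul_add, Finset.sum_add_distrib, Pi.single_apply]
  simp [Int.cast_ite, ite_mul, mul_ite]

def lp (a : ℤ) (p : ℝ) : Prop := 0 < a ∨ (a = 0 ∧ 0 < p)

theorem lp.nonneg {a : ℤ} {p : ℝ} (h : lp a p) : 0 ≤ a := by
  rcases h with h | h <;> omega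

theorem lp.add {a b : ℤ} {p r : ℝ} (h : lp a p) (h' : lp b r) : lp (a + b) (p + r) := by
  rcases h with h | ⟨h, hp⟩ <;> rcases h' with h' | ⟨h', hr⟩
  · left; omega
  · left; omega
  · left; omega
  · right; exact ⟨by omega, by linarith⟩

theorem not_lp {a : ℤ} {p : ℝ} (hp : p ≠ 0) : ¬ lp a p ↔ lp (-a) (-p) := by
  unfold lp
  constructor
  · intro h
    push Not at h
    rcases lt_trichotomy a 0 with ha | ha | ha
    · left; omega
    · right; refine ⟨by omega, ?_⟩
      have := h.2 ha
      have : p < 0 := lt_of_le_of_ne this hp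
      linarith
    · omega
  · rintro (h | ⟨h, hq⟩) (h' | ⟨h', hq'⟩)
    · omega
    · omega
    · omega
    · linarith

def SS (Λ : List (ι → ℤ)) (w : ι → ℤ) (q : ι → ℝ) (n : ℕ) : Set (ι → ℤ) :=
  {α | (∀ l, lp (α l) (q l)) ∧ (∀ c ∈ Λ, lp (dot c α) (dot c q)) ∧ dot w α = (n : ℤ)}

noncomputable def FF (Λ : List (ι → ℤ)) (w : ι → ℤ) (q : ι → ℝ) : PowerSeries ℚ :=
  PowerSeries.mk fun n => ((SS Λ w q n).ncard : ℚ)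

def Hyp (Λ : List (ι → ℤ)) (w : ι → ℤ) : Prop :=
  (∀ α : ι → ℤ, (∀ l, 0 ≤ α l) → (∀ c ∈ Λ, 0 ≤ dot c α) → 0 ≤ dot w α) ∧
  ∀ n : ℤ, {α : ι → ℤ | (∀ l, 0 ≤ α l) ∧ (∀ c ∈ Λ, 0 ≤ dot c α) ∧ dot w α = n}.Finite

def Indep (q : ι → ℝ) : Prop := ∀ c : ι → ℤ, dot c q = 0 → c = 0

def Rec (N : ℕ) (f g : PowerSeries ℚ) : Prop :=
  ∃ (A B : Polynomial ℚ) (D : ℕ), A.natDegree ≤ D ∧ B.natDegree ≤ D ∧ B.coeff 0 ≠ 0 ∧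
    B.coeff D ≠ 0 ∧ f * (B : PowerSeries ℚ) = A ∧
    g * ((Polynomial.reflect D B : Polynomial ℚ) : PowerSeries ℚ)
      = (((-1) ^ N * Polynomial.reflect D A : Polynomial ℚ) : PowerSeries ℚ)

theorem Rec.zero (N : ℕ) : Rec N 0 0 :=
  ⟨0, 1, 0, by simp, by simp, by simp, by simp, by simp, by simp⟩

theorem Rec.add {N : ℕ} {f g f' g' : PowerSeries ℚ} (h : Rec N f g) (h' : Rec N f' g') :
    Rec N (f + f') (g + g') := by
  obtain ⟨A, B, D, hA, hB, h0, hD, hf, hg⟩ := h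
  obtain ⟨A', B', D', hA', hB', h0', hD', hf', hg'⟩ := h'
  refine ⟨A * B' + B * A', B * B', D + D', ?_, ?_, ?_, ?_, ?_, ?_⟩
  · refine (Polynomial.natDegree_add_le _ _).trans (max_le ?_ ?_)
    · exact Polynomial.natDegree_mul_le.trans (by omega)
    · exact Polynomial.natDegree_mul_le.trans (by omega)
  · exact Polynomial.natDegree_mul_le.trans (by omega)
  · rw [Polynomial.mul_coeff_zero]; exact mul_ne_zero h0 h0'
  · rw [Polynomial.coeff_mul_add_eq_of_natDegree_le hB hB']; exact mul_ne_zero hD hD'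
  · push_cast
    rw [← hf, ← hf']; ring
  · rw [Polynomial.reflect_add, Polynomial.reflect_mul _ _ hB hB', Polynomial.reflect_mul _ _ hA hB',
      Polynomial.reflect_mul _ _ hB hA']
    push_cast at hg hg' ⊢
    linear_combination ((Polynomial.reflect D' B' : Polynomial ℚ) : PowerSeries ℚ) * hg
      + ((Polynomial.reflect D B : Polynomial ℚ) : PowerSeries ℚ) * hg'

theorem SS_finite {Λ : List (ι → ℤ)} {w : ι → ℤ} (h : Hyp Λ w) (q : ι → ℝ) (n : ℕ) :
    (SS Λ w q n).Finite :=
  (h.2 n).subset fun _ hα => ⟨fun l => (hα.1 l).nonneg, fun c hc => (hα.2.1 c hc).nonneg, hα.2.2⟩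

theorem Hyp.TT {Λ : List (ι → ℤ)} {w : ι → ℤ} (h : Hyp Λ w) {i j : ι} (hij : i ≠ j) :
    Hyp (Λ.map (TT i j)) (TT i j w) := by
  have key : ∀ α : ι → ℤ, (∀ l, 0 ≤ α l) → ∀ l, 0 ≤ UU i j α l := by
    intro α hα l
    simp only [UU, Pi.add_apply, Pi.single_apply]
    have := hα l; have := hα j
    split_ifs <;> omega
  constructor
  · intro α hα hc
    rw [dot_TT hij]
    refine h.1 _ (key α hα) fun c hcc => ?_
    have := hc _ (List.mem_map_of_mem hcc)
    rwa [dot_TT hij] at this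
  · intro n
    refine ((h.2 n).preimage (f := UU i j) ?_).subset ?_
    · exact (Function.LeftInverse.injective (VV_UU hij)).injOn
    · rintro α ⟨hα, hc, hn⟩
      refine ⟨key α hα, fun c hcc => ?_, ?_⟩
      · have := hc _ (List.mem_map_of_mem hcc)
        rwa [dot_TT hij] at this
      · rwa [dot_TT hij] at hn

theorem Indep.VV {q : ι → ℝ} (h : Indep q) {i j : ι} (hij : i ≠ j) : Indep (VV i j q) := by
  intro c hc
  have h1 : TT i j (c - Pi.single j (c i)) = c := by
    funext l
    simp [TT, Pi.single_apply, hij]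
  rw [← h1, dot_TT hij, UU_VV hij] at hc
  have := h _ hc
  rw [this] at h1
  rw [← h1]
  funext l; simp [TT, Pi.single_apply]

theorem Indep.ne {q : ι → ℝ} (h : Indep q) {i j : ι} (hij : i ≠ j) : q i - q j ≠ 0 := by
  intro h0
  have := h (Pi.single i 1 - Pi.single j 1) (by
    unfold dot
    simp [Pi.single_apply, Int.cast_ite, sub_mul, h0])
  have := congrFun this i
  simp [Pi.single_apply, hij] at this

theorem Indep.ne_zero {q : ι → ℝ} (h : Indep q) (i : ι) : q i ≠ 0 := by
  intro h0
  have := h (Pi.single i 1) (by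
    unfold dot
    simp [Pi.single_apply, Int.cast_ite, h0])
  have := congrFun this i
  simp at this

theorem Indep.neg {q : ι → ℝ} (h : Indep q) : Indep (-q) := by
  intro c hc
  apply h
  simpa [dot] using hc

theorem SS_half {Λ : List (ι → ℤ)} {w : ι → ℤ} (q : ι → ℝ) {i j : ι}
    (hij : i ≠ j) (n : ℕ) :
    SS Λ w q n ∩ {α | lp (α i - α j) (q i - q j)} =
      UU i j '' SS (Λ.map (TT i j)) (TT i j w) (VV i j q) n := by
  ext α
  constructor
  · rintro ⟨⟨h1, h2, h3⟩, h4⟩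
    refine ⟨VV i j α, ⟨?_, ?_, ?_⟩, UU_VV hij α⟩
    · intro l
      by_cases hl : l = i
      · subst hl; simpa [VV] using h4
      · simpa [VV, hl, Pi.single_apply] using h1 l
    · intro c hc
      obtain ⟨c', hc', rfl⟩ := List.mem_map.1 hc
      rw [dot_TT hij, dot_TT hij, UU_VV hij, UU_VV hij]
      exact h2 _ hc'
    · rw [dot_TT hij, UU_VV hij]; exact h3
  · rintro ⟨β, ⟨h1, h2, h3⟩, rfl⟩
    have hi := h1 i
    have hj := h1 j
    simp only [VV, Pi.sub_apply, Pi.single_apply, hij.symm, if_true, if_false, sub_zero] at hi hj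
    refine ⟨⟨?_, ?_, ?_⟩, ?_⟩
    · intro l
      by_cases hl : l = i
      · subst hl
        have := hi.add hj
        simpa [UU] using this
      · simpa [UU, VV, hl, Pi.single_apply] using h1 l
    · intro c hc
      have := h2 _ (List.mem_map_of_mem hc)
      rwa [dot_TT hij, dot_TT hij, UU_VV hij] at this
    · rwa [dot_TT hij] at h3
    · simpa [UU, Pi.single_apply, hij.symm] using hi

theorem FF_split {Λ : List (ι → ℤ)} {w : ι → ℤ} (h : Hyp Λ w) {q : ι → ℝ} (hq : Indep q) {i j : ι}
    (hij : i ≠ j) :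
    FF Λ w q = FF (Λ.map (TT i j)) (TT i j w) (VV i j q)
      + FF (Λ.map (TT j i)) (TT j i w) (VV j i q) := by
  ext n
  simp only [FF, PowerSeries.coeff_mk, map_add]
  rw [← Set.ncard_inter_add_ncard_sdiff_eq_ncard (SS Λ w q n) {α | lp (α i - α j) (q i - q j)}
    (SS_finite h q n)]
  have h2 : SS Λ w q n \ {α | lp (α i - α j) (q i - q j)} =
      SS Λ w q n ∩ {α | lp (α j - α i) (q j - q i)} := by
    ext α
    have := not_lp (a := α i - α j) (hq.ne hij)
    simp only [neg_sub] at this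
    simp [this]
  rw [h2, SS_half q hij, SS_half q hij.symm,
    Set.ncard_image_of_injective _ (Function.LeftInverse.injective (VV_UU hij)),
    Set.ncard_image_of_injective _ (Function.LeftInverse.injective (VV_UU hij.symm))]
  push_cast; rfl

theorem elliott_step (P : (ι → ℤ) → Prop) (h0 : ∀ c, (∀ l, 0 ≤ c l) → P c)
    (hs : ∀ c i j, 0 < c i → c j < 0 → P (TT i j c) → P (TT j i c) → P c)
    (L B : ℤ) (hL : 1 ≤ L) (hB : 0 ≤ B) (hBL : B ≤ L)
    (hind : ∀ c : ι → ℤ, (∀ l, -B ≤ c l ∧ c l ≤ L - 1) → P c) :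
    ∀ m : ℕ, ∀ c : ι → ℤ, (Finset.univ.filter fun l => c l < 0 ∨ c l = L).card = m →
      (∀ l, -B ≤ c l ∧ c l ≤ L) → P c := by
  intro m
  induction m using Nat.strong_induction_on with
  | _ m ih =>
  intro c hm hc
  by_cases h1 : ∃ i, c i = L
  · by_cases h2 : ∃ j, c j < 0
    · obtain ⟨i, hi⟩ := h1
      obtain ⟨j, hj⟩ := h2
      have hij : i ≠ j := by rintro rfl; omega
      have hcj := hc j
      have e1 : ∀ l, TT i j c l = if l = j then c i + c j else c l := by
        intro l; simp only [TT, Pi.add_apply, Pi.single_apply]; split_ifs with h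
        · subst h; ring
        · ring
      have e2 : ∀ l, TT j i c l = if l = i then c i + c j else c l := by
        intro l; simp only [TT, Pi.add_apply, Pi.single_apply]; split_ifs with h
        · subst h; ring
        · ring
      refine hs c i j (by omega) hj (ih _ ?_ _ rfl ?_) (ih _ ?_ _ rfl ?_)
      · rw [← hm]
        apply Finset.card_lt_card
        rw [Finset.ssubset_iff_of_subset]
        · exact ⟨j, by simp [hj], by simp [e1]; omega⟩
        · intro l
          simp only [Finset.mem_filter, Finset.mem_univ, true_and, e1]
          split_ifs <;> omega
      · intro l; rw [e1]; have := hc l; split_ifs <;> omega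
      · rw [← hm]
        apply Finset.card_lt_card
        rw [Finset.ssubset_iff_of_subset]
        · exact ⟨i, by simp [hi], by simp [e2]; omega⟩
        · intro l
          simp only [Finset.mem_filter, Finset.mem_univ, true_and, e2]
          split_ifs <;> omega
      · intro l; rw [e2]; have := hc l; split_ifs <;> omega
    · push Not at h2; exact h0 c h2
  · push Not at h1
    exact hind c fun l => ⟨(hc l).1, by have := (hc l).2; have := h1 l; omega⟩

theorem elliott_aux : ∀ m : ℕ, ∀ A B : ℕ, A + B = m → ∀ P : (ι → ℤ) → Prop,
    (∀ c, (∀ l, 0 ≤ c l) → P c) → (∀ c, (∀ l, c l ≤ 0) → P c) →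
    (∀ c i j, 0 < c i → c j < 0 → P (TT i j c) → P (TT j i c) → P c) →
    ∀ c : ι → ℤ, (∀ l, -(B : ℤ) ≤ c l ∧ c l ≤ A) → P c := by
  intro m
  induction m with
  | zero =>
    intro A B hAB P h0 h1 hs c hc
    exact h0 c fun l => by have := hc l; omega
  | succ m ih =>
    intro A B hAB P h0 h1 hs c hc
    by_cases h : B ≤ A
    · refine elliott_step P h0 hs A B (by omega) (by omega) (by omega) ?_ _ c rfl hc
      intro c' hc'
      exact ih (A - 1) B (by omega) P h0 h1 hs c' fun l => by have := hc' l; omega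
    · have hneg : ∀ (i j : ι) (c : ι → ℤ), -(TT i j c) = TT i j (-c) := by
        intro i j c; funext l; simp [TT, Pi.single_apply]; split_ifs <;> ring
      have := elliott_step (fun c => P (-c)) (fun c hc => h1 _ fun l => by
          have := hc l; simp; omega)
        (fun c i j hi hj h2 h3 => hs (-c) j i (by simp; omega) (by simp; omega)
          (by rw [← hneg]; exact h3) (by rw [← hneg]; exact h2))
        B A (by omega) (by omega) (by omega) (fun c' hc' =>
          ih A (B - 1) (by omega) P h0 h1 hs (-c') fun l => by
            have := hc' l; simp only [Pi.neg_apply]; omega) _ (-c) rfl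
        (fun l => by have := hc l; simp only [Pi.neg_apply]; omega)
      simpa using this

theorem elliott_ind (P : (ι → ℤ) → Prop) (h0 : ∀ c, (∀ l, 0 ≤ c l) → P c)
    (h1 : ∀ c, (∀ l, c l ≤ 0) → P c)
    (hs : ∀ c i j, 0 < c i → c j < 0 → P (TT i j c) → P (TT j i c) → P c) (c : ι → ℤ) : P c := by
  refine elliott_aux _ (∑ l, (c l).natAbs) (∑ l, (c l).natAbs) rfl P h0 h1 hs c fun l => ?_
  have : (c l).natAbs ≤ ∑ l, (c l).natAbs :=
    Finset.single_le_sum (f := fun l => (c l).natAbs) (fun _ _ => Nat.zero_le _) (Finset.mem_univ l)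
  omega

theorem lp_dot_of_nonneg {c α : ι → ℤ} {q : ι → ℝ} (hc : ∀ l, 0 ≤ c l) (hc0 : c ≠ 0)
    (h : ∀ l, lp (α l) (q l)) : lp (dot c α) (dot c q) := by
  have hn : ∀ l ∈ Finset.univ, 0 ≤ ((c l : ℤ) : ℤ) * α l := fun l _ => mul_nonneg (hc l) (h l).nonneg
  rcases (Finset.sum_nonneg hn).lt_or_eq with h1 | h1
  · left; simpa [dot] using h1
  · right
    refine ⟨by simpa [dot] using h1.symm, ?_⟩
    have h2 := (Finset.sum_eq_zero_iff_of_nonneg hn).1 h1.symm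
    have h3 : ∀ l, 0 < c l → 0 < q l := by
      intro l hl
      have := h2 l (Finset.mem_univ l)
      rcases h l with h4 | h4
      · have := mul_pos hl h4
        omega
      · exact h4.2
    obtain ⟨l, hl⟩ : ∃ l, c l ≠ 0 := by
      by_contra hh; push Not at hh; exact hc0 (funext hh)
    have hl' : 0 < c l := lt_of_le_of_ne (hc l) hl.symm
    refine Finset.sum_pos' (fun l _ => ?_) ⟨l, Finset.mem_univ l, ?_⟩
    · rcases (hc l).lt_or_eq with h5 | h5
      · exact (mul_pos (by exact_mod_cast h5) (h3 l h5)).le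
      · simp [← h5]
    · exact mul_pos (by exact_mod_cast hl') (h3 l hl')

theorem not_lp_dot_of_nonpos {c α : ι → ℤ} {q : ι → ℝ} (hc : ∀ l, c l ≤ 0)
    (h : ∀ l, lp (α l) (q l)) : ¬ lp (dot c α) (dot c q) := by
  intro h1
  by_cases hc0 : c = 0
  · subst hc0; simp [dot, lp] at h1
  · have h2 := lp_dot_of_nonneg (c := -c) (fun l => by have := hc l; simp; omega) (by simpa using hc0) h
    have h3 := h1.add h2
    simp [dot, lp] at h3

noncomputable def leaf (w : ℕ) (q : ℝ) : PowerSeries ℚ :=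
  open Classical in PowerSeries.mk fun n => if ∃ a : ℤ, lp a q ∧ (w : ℤ) * a = n then 1 else 0

theorem leaf_mul (w : ℕ) (hw : 0 < w) (q : ℝ) :
    leaf w q * (((1 - Polynomial.X ^ w : Polynomial ℚ)) : PowerSeries ℚ) =
      ((if 0 < q then 1 else Polynomial.X ^ w : Polynomial ℚ) : PowerSeries ℚ) := by
  classical
  have hco : ∀ n : ℕ, (∃ a : ℤ, lp a q ∧ (w : ℤ) * a = n) ↔ (w ∣ n ∧ (0 < n ∨ 0 < q)) := by
    intro n
    constructor
    · rintro ⟨a, h1, h2⟩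
      refine ⟨by zify; exact ⟨a, h2.symm⟩, ?_⟩
      rcases h1 with h1 | h1
      · left; have : 0 < (w : ℤ) * a := by positivity
        omega
      · right; exact h1.2
    · rintro ⟨⟨a, rfl⟩, h⟩
      refine ⟨a, ?_, by push_cast; rfl⟩
      rcases h with h | h
      · left
        have := Nat.pos_of_mul_pos_left h
        first
        | exact_mod_cast this
        | (have := pos_of_mul_pos_right h (Nat.zero_le _); exact_mod_cast this)
      · rcases Nat.eq_zero_or_pos a with h0 | h0
        · right; exact ⟨by simp [h0], h⟩
        · left; exact_mod_cast h0
  ext n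
  have e : leaf w q * (((1 - Polynomial.X ^ w : Polynomial ℚ)) : PowerSeries ℚ) =
      leaf w q - leaf w q * PowerSeries.X ^ w := by
    push_cast; ring
  rw [e, map_sub, PowerSeries.coeff_mul_X_pow']
  simp only [leaf, PowerSeries.coeff_mk, hco, Polynomial.coeff_coe]
  by_cases hn : w ≤ n
  · have hd : w ∣ n - w ↔ w ∣ n := by
      rw [Nat.dvd_sub_iff_left hn (dvd_refl w)]
    by_cases hq : 0 < q
    · have : n ≠ 0 := by omega
      simp [hn, hq, hd, Polynomial.coeff_one, this]
    · by_cases hnw : n = w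
      · subst hnw; simp [hq, hw]
      · have h1 : 0 < n := by omega
        have h2 : 0 < n - w := by omega
        simp [hn, hq, hd, Polynomial.coeff_X_pow, hnw, h1, show w < n by omega]
  · have h1 : n ≠ w := by omega
    rcases Nat.eq_zero_or_pos n with h0 | h0
    · subst h0
      by_cases hq : 0 < q
      · simp [hq]; omega
      · simp [hq, Polynomial.coeff_X_pow]; omega
    · have h2 : ¬ w ∣ n := fun h => hn (Nat.le_of_dvd h0 h)
      by_cases hq : 0 < q
      · simp [hn, h2, hq, Polynomial.coeff_one]; omega
      · simp [hn, h2, hq, Polynomial.coeff_X_pow, h1]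

theorem FF_leaf (w : ι → ℕ) (hw : ∀ l, 0 < w l) (q : ι → ℝ) :
    FF [] (fun l => (w l : ℤ)) q = ∏ l, leaf (w l) (q l) := by
  classical
  ext n
  rw [PowerSeries.coeff_prod]
  simp only [FF, leaf, PowerSeries.coeff_mk]
  simp only [Finset.prod_ite_zero, Finset.prod_const_one, Finset.sum_boole]
  congr 1
  rw [← Set.ncard_coe_finset]
  have hinj : Function.Injective (fun (α : ι → ℤ) => Finsupp.equivFunOnFinite.symm
      (fun l => (w l : ℤ) * α l)) := by
    intro α β h
    have h := Finsupp.equivFunOnFinite.symm.injective h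
    funext l
    have := congrFun h l
    exact mul_left_cancel₀ (by have := hw l; omega) this
  have hinj2 : Function.Injective (fun (f : ι →₀ ℕ) => Finsupp.equivFunOnFinite.symm
      (fun l => (f l : ℤ))) := by
    intro α β h
    have h := Finsupp.equivFunOnFinite.symm.injective h
    ext l
    have := congrFun h l
    exact_mod_cast this
  rw [← Set.ncard_image_of_injective _ hinj, ← Set.ncard_image_of_injective _ hinj2]
  congr 1
  ext g
  constructor
  · rintro ⟨α, ⟨h1, -, h3⟩, rfl⟩
    refine ⟨Finsupp.equivFunOnFinite.symm (fun l => w l * (α l).toNat), ?_, ?_⟩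
    · simp only [Finset.coe_filter, Set.mem_ofPred_eq, Finset.mem_finsuppAntidiag]
      refine ⟨⟨?_, by simp⟩, ?_⟩
      · zify
        rw [← h3]
        unfold dot
        refine Finset.sum_congr rfl fun l _ => ?_
        have := (h1 l).nonneg
        simp [this]
      · intro l _
        refine ⟨α l, h1 l, ?_⟩
        have := (h1 l).nonneg
        simp [this]
    · ext l
      have := (h1 l).nonneg
      simp [this]
  · rintro ⟨f, hf, rfl⟩
    simp only [Finset.coe_filter, Set.mem_ofPred_eq, Finset.mem_finsuppAntidiag] at hf
    obtain ⟨⟨h1, -⟩, h2⟩ := hf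
    choose a ha using fun l => h2 l (Finset.mem_univ l)
    refine ⟨a, ⟨fun l => (ha l).1, by simp, ?_⟩, ?_⟩
    · unfold dot
      rw [← h1]
      push_cast
      exact Finset.sum_congr rfl fun l _ => (ha l).2
    · ext l; simpa using (ha l).2

theorem reflect_prod {κ : Type} (s : Finset κ) (f : κ → Polynomial ℚ) (d : κ → ℕ)
    (hf : ∀ l, (f l).natDegree ≤ d l) :
    Polynomial.reflect (∑ l ∈ s, d l) (∏ l ∈ s, f l) = ∏ l ∈ s, Polynomial.reflect (d l) (f l) := by
  classical
  induction s using Finset.induction_on with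
  | empty => simp
  | insert a s ha ih =>
    rw [Finset.sum_insert ha, Finset.prod_insert ha, Finset.prod_insert ha,
      Polynomial.reflect_mul _ _ (hf a), ih]
    exact (Polynomial.natDegree_prod_le _ _).trans (Finset.sum_le_sum fun l _ => hf l)

theorem Rec_leaf (w : ι → ℕ) (hw : ∀ l, 0 < w l) (q : ι → ℝ) (hq : ∀ l, q l ≠ 0) :
    Rec (Fintype.card ι) (FF [] (fun l => (w l : ℤ)) q) (FF [] (fun l => (w l : ℤ)) (-q)) := by
  have hB : ∀ l, (1 - Polynomial.X ^ (w l) : Polynomial ℚ).natDegree ≤ w l := by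
    intro l
    exact (Polynomial.natDegree_sub_le _ _).trans (by simp)
  have hA : ∀ l, (if 0 < q l then 1 else Polynomial.X ^ (w l) : Polynomial ℚ).natDegree ≤ w l := by
    intro l
    split_ifs <;> simp
  have hrB : ∀ l, Polynomial.reflect (w l) (1 - Polynomial.X ^ (w l) : Polynomial ℚ)
      = (-1) * (1 - Polynomial.X ^ (w l) : Polynomial ℚ) := by
    intro l
    rw [Polynomial.reflect_sub, Polynomial.reflect_one]
    have : Polynomial.reflect (w l) (Polynomial.X ^ (w l) : Polynomial ℚ) = 1 := by
      have := Polynomial.reflect_monomial (R := ℚ) (w l) (w l)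
      simpa [Polynomial.revAt_le] using this
    rw [this]; ring
  have hrA : ∀ l, Polynomial.reflect (w l) (if 0 < q l then 1 else Polynomial.X ^ (w l) : Polynomial ℚ)
      = (if 0 < -q l then 1 else Polynomial.X ^ (w l) : Polynomial ℚ) := by
    intro l
    rcases lt_or_gt_of_ne (hq l) with h | h
    · have h' : ¬ 0 < q l := by linarith
      have h'' : 0 < - q l := by linarith
      rw [if_neg h', if_pos h'']
      have := Polynomial.reflect_monomial (R := ℚ) (w l) (w l)
      simpa [Polynomial.revAt_le] using this
    · have h'' : ¬ 0 < - q l := by linarith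
      rw [if_pos h, if_neg h'']
      exact Polynomial.reflect_one _
  refine ⟨∏ l, (if 0 < q l then 1 else Polynomial.X ^ (w l)), ∏ l, (1 - Polynomial.X ^ (w l)),
    ∑ l, w l, ?_, ?_, ?_, ?_, ?_, ?_⟩
  · exact (Polynomial.natDegree_prod_le _ _).trans (Finset.sum_le_sum fun l _ => hA l)
  · exact (Polynomial.natDegree_prod_le _ _).trans (Finset.sum_le_sum fun l _ => hB l)
  · rw [Polynomial.coeff_zero_eq_eval_zero, Polynomial.eval_prod]
    refine Finset.prod_ne_zero_iff.2 fun l _ => ?_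
    have := (hw l).ne'
    simp [this]
  · have hr := congrArg (fun p => Polynomial.coeff p 0)
      (reflect_prod Finset.univ (fun l => (1 - Polynomial.X ^ (w l) : Polynomial ℚ)) w hB)
    simp only [Polynomial.coeff_reflect, Polynomial.revAt_le (Nat.zero_le _), Nat.sub_zero] at hr
    rw [hr, Polynomial.coeff_zero_eq_eval_zero, Polynomial.eval_prod]
    refine Finset.prod_ne_zero_iff.2 fun l _ => ?_
    rw [hrB]
    have := (hw l).ne'
    simp [this]
  · rw [FF_leaf w hw]
    have : ∀ (f : ι → Polynomial ℚ), ((∏ l, f l : Polynomial ℚ) : PowerSeries ℚ) = ∏ l, (f l : PowerSeries ℚ) :=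
      fun f => map_prod (Polynomial.coeToPowerSeries.ringHom (R := ℚ)) f _
    rw [this, this, ← Finset.prod_mul_distrib]
    exact Finset.prod_congr rfl fun l _ => leaf_mul _ (hw l) _
  · rw [FF_leaf w hw, reflect_prod _ _ _ hB, reflect_prod _ _ _ hA]
    simp only [hrA, hrB]
    have : ∀ (f : ι → Polynomial ℚ), ((∏ l, f l : Polynomial ℚ) : PowerSeries ℚ) = ∏ l, (f l : PowerSeries ℚ) :=
      fun f => map_prod (Polynomial.coeToPowerSeries.ringHom (R := ℚ)) f _
    rw [Finset.prod_mul_distrib, Finset.prod_const, Finset.card_univ]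
    rw [Polynomial.coe_mul, Polynomial.coe_mul, this, this, mul_left_comm]
    rw [← Finset.prod_mul_distrib]
    congr 1
    exact Finset.prod_congr rfl fun l _ => leaf_mul _ (hw l) _

theorem rec_main : ∀ m : ℕ, ∀ Λ : List (ι → ℤ), Λ.length = m → ∀ (w : ι → ℤ) (q : ι → ℝ),
    Indep q → Hyp Λ w → Rec (Fintype.card ι) (FF Λ w q) (FF Λ w (-q)) := by
  intro m
  induction m with
  | zero =>
    intro Λ hΛ w q hq hH
    obtain rfl := List.length_eq_zero_iff.1 hΛ
    have hdot : ∀ l (m : ℤ), dot w (Pi.single l m) = w l * m := by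
      intro l m; simp [dot, Pi.single_apply]
    have hs0 : ∀ l (m : ℕ), ∀ l', 0 ≤ (Pi.single l (m : ℤ) : ι → ℤ) l' := by
      intro l m l'; rw [Pi.single_apply]; split_ifs <;> omega
    have hw : ∀ l, 0 < w l := by
      intro l
      have h1 := hH.1 (Pi.single l ((1 : ℕ) : ℤ)) (hs0 l 1) (by simp)
      rw [hdot] at h1
      rcases (show 0 ≤ w l by simpa using h1).lt_or_eq with h2 | h2
      · exact h2
      · exfalso
        refine Set.infinite_of_injective_forall_mem (f := fun m : ℕ => (Pi.single l (m : ℤ) : ι → ℤ)) ?_ ?_ (hH.2 0)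
        · intro a b hab
          have := congrFun hab l
          simpa using this
        · intro m
          exact ⟨hs0 l m, by simp, by rw [hdot, ← h2]; simp⟩
    have hw' : w = fun l => ((w l).toNat : ℤ) := by
      funext l; have := hw l; omega
    rw [hw']
    exact Rec_leaf _ (fun l => by have := hw l; omega) q hq.ne_zero
  | succ m ih =>
    intro Λ hΛ w q hq hH
    obtain ⟨c, Λ', rfl⟩ := List.exists_cons_of_length_eq_add_one hΛ
    have hΛ' : Λ'.length = m := by simpa using hΛ
    revert Λ' w q
    refine elliott_ind (fun c => ∀ (Λ' : List (ι → ℤ)) w q, Indep q → (c :: Λ').length = m + 1 →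
      Hyp (c :: Λ') w → Λ'.length = m → Rec (Fintype.card ι) (FF (c :: Λ') w q) (FF (c :: Λ') w (-q)))
      ?_ ?_ ?_ c |> fun h => fun w q hq Λ' h1 h2 h3 => h Λ' w q hq h1 h2 h3
    · intro c hc Λ' w q hq _ hH hl
      by_cases hc0 : c = 0
      · have : ∀ q, FF (c :: Λ') w q = 0 := by
          intro q
          ext n
          have : SS (c :: Λ') w q n = ∅ := by
            ext α
            simp only [Set.mem_empty_iff_false, iff_false]
            rintro ⟨h1, h2, -⟩
            exact not_lp_dot_of_nonpos (by simp [hc0]) h1 (h2 c (by simp))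
          simp [FF, this]
        rw [this, this]; exact Rec.zero _
      · have : ∀ q, FF (c :: Λ') w q = FF Λ' w q := by
          intro q
          ext n
          have : SS (c :: Λ') w q n = SS Λ' w q n := by
            ext α
            constructor
            · rintro ⟨h1, h2, h3⟩
              exact ⟨h1, fun c' hc' => h2 c' (by simp [hc']), h3⟩
            · rintro ⟨h1, h2, h3⟩
              refine ⟨h1, fun c' hc' => ?_, h3⟩
              rcases List.mem_cons.1 hc' with rfl | h
              · exact lp_dot_of_nonneg hc hc0 h1
              · exact h2 c' h
          simp [FF, this]
        rw [this, this]
        have hcn : ∀ α : ι → ℤ, (∀ l, 0 ≤ α l) → 0 ≤ dot c α := fun α hα =>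
          Finset.sum_nonneg fun l _ => mul_nonneg (hc l) (hα l)
        refine ih Λ' hl w q hq ⟨fun α h1 h2 => hH.1 α h1 fun c' hc' => ?_, fun n =>
          (hH.2 n).subset ?_⟩
        · rcases List.mem_cons.1 hc' with rfl | h
          · exact hcn α h1
          · exact h2 c' h
        · rintro α ⟨h1, h2, h3⟩
          refine ⟨h1, fun c' hc' => ?_, h3⟩
          rcases List.mem_cons.1 hc' with rfl | h
          · exact hcn α h1
          · exact h2 c' h
    · intro c hc Λ' w q hq _ hH hl
      have : ∀ q, FF (c :: Λ') w q = 0 := by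
        intro q
        ext n
        have : SS (c :: Λ') w q n = ∅ := by
          ext α
          simp only [Set.mem_empty_iff_false, iff_false]
          rintro ⟨h1, h2, -⟩
          exact not_lp_dot_of_nonpos hc h1 (h2 c (by simp))
        simp [FF, this]
      rw [this, this]; exact Rec.zero _
    · intro c i j hi hj P1 P2 Λ' w q hq hlen hH hl
      have hij : i ≠ j := by rintro rfl; omega
      have hVn : ∀ i j : ι, VV i j (-q) = -(VV i j q) := by
        intro i j; funext l; simp [VV, Pi.single_apply]; split_ifs <;> ring
      rw [FF_split hH hq hij, FF_split hH hq.neg hij, hVn, hVn]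
      refine Rec.add ?_ ?_
      · exact P1 (Λ'.map (TT i j)) _ _ (hq.VV hij) (by simp [hl]) (hH.TT hij) (by simp [hl])
      · exact P2 (Λ'.map (TT j i)) _ _ (hq.VV hij.symm) (by simp [hl]) (hH.TT hij.symm) (by simp [hl])

end HypEhr
namespace HypEhr
theorem reflect_shift (p : Polynomial ℚ) (m d : ℕ) (h : p.natDegree ≤ m) :
    Polynomial.reflect (m + d) p = Polynomial.reflect m p * Polynomial.X ^ d := by
  have := Polynomial.reflect_mul p 1 h (show (1 : Polynomial ℚ).natDegree ≤ d by simp)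
  rwa [mul_one, Polynomial.reflect_one] at this

theorem X_pow_le {p p' : Polynomial ℚ} {m n : ℕ} (hp : p.coeff 0 ≠ 0)
    (h : Polynomial.X ^ m * p = Polynomial.X ^ n * p') : n ≤ m := by
  by_contra hlt
  have := congrArg (fun r => Polynomial.coeff r m) h
  simp only [Polynomial.coeff_X_pow_mul', le_refl, if_true, Nat.sub_self] at this
  rw [if_neg (by omega)] at this
  exact hp this

theorem algebra_end {M Q A B : Polynomial ℚ} {D s N : ℕ} (hcop : IsCoprime M Q)
    (hQ0 : Q.coeff 0 = 1) (hM0 : M.coeff 0 = 1) (hA : A.natDegree ≤ D) (hB : B.natDegree ≤ D)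
    (hBD : B.coeff D ≠ 0) (hB0 : B.coeff 0 ≠ 0) (h1 : M * B = Q * A)
    (h2 : Polynomial.X ^ (s + 1) * M * Polynomial.reflect D B = (-1) ^ N * Q * Polynomial.reflect D A)
    (hQ1 : Q.eval 1 = 0) :
    M.natDegree = Q.natDegree - (s + 1) ∧
      ∀ i ≤ Q.natDegree - (s + 1), M.coeff i = M.coeff (Q.natDegree - (s + 1) - i) := by
  have hM : M ≠ 0 := by rintro rfl; simp at hM0
  have hQ : Q ≠ 0 := by rintro rfl; simp at hQ0
  have hBne : B ≠ 0 := by rintro rfl; simp at hB0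
  have hAne : A ≠ 0 := by
    rintro rfl; rw [mul_zero] at h1; exact mul_ne_zero hM hBne h1
  have hBdeg : B.natDegree = D := le_antisymm hB (Polynomial.le_natDegree_of_ne_zero hBD)
  have hdeg := congrArg Polynomial.natDegree h1
  rw [Polynomial.natDegree_mul hM hBne, Polynomial.natDegree_mul hQ hAne, hBdeg] at hdeg
  set a := M.natDegree with ha
  set b := Q.natDegree with hb
  have hab : a ≤ b := by omega
  have hr : Q.reverse * Polynomial.reflect D A
      = M.reverse * Polynomial.reflect D B * Polynomial.X ^ (b - a) := by
    have e1 : Polynomial.reflect (b + D) (Q * A) = Q.reverse * Polynomial.reflect D A :=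
      Polynomial.reflect_mul _ _ le_rfl hA
    have e2 : Polynomial.reflect (a + D) (M * B) = M.reverse * Polynomial.reflect D B :=
      Polynomial.reflect_mul _ _ le_rfl hB
    rw [← e1, ← e2, ← h1, show b + D = a + D + (b - a) by omega]
    refine reflect_shift _ _ _ ?_
    exact Polynomial.natDegree_mul_le.trans (by omega)
  have hrB : Polynomial.reflect D B ≠ 0 := by
    intro h
    exact hBne (Polynomial.reflect_eq_zero_iff.1 h)
  have h3 : Polynomial.X ^ (s + 1) * (M * Q.reverse)
      = Polynomial.X ^ (b - a) * ((-1) ^ N * (Q * M.reverse)) := by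
    apply mul_right_cancel₀ hrB
    linear_combination Q.reverse * h2 + (-1) ^ N * Q * hr
  have hsgn : ((-1 : Polynomial ℚ) ^ N).coeff 0 ≠ 0 := by
    rw [Polynomial.coeff_zero_eq_eval_zero]; simp
  have hn1 : (M * Q.reverse).coeff 0 ≠ 0 := by
    rw [Polynomial.mul_coeff_zero, hM0, Polynomial.coeff_zero_reverse, one_mul]
    exact Polynomial.leadingCoeff_ne_zero.2 hQ
  have hn2 : ((-1) ^ N * (Q * M.reverse)).coeff 0 ≠ 0 := by
    rw [Polynomial.mul_coeff_zero, Polynomial.mul_coeff_zero, hQ0, Polynomial.coeff_zero_reverse, one_mul]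
    exact mul_ne_zero hsgn (Polynomial.leadingCoeff_ne_zero.2 hM)
  have hs : s + 1 = b - a := le_antisymm (X_pow_le hn2 h3.symm) (X_pow_le hn1 h3)
  rw [← hs] at h3
  have h4 := mul_left_cancel₀ (pow_ne_zero _ Polynomial.X_ne_zero) h3
  have hdvd : M ∣ M.reverse := by
    have : M ∣ (-1) ^ N * (Q * M.reverse) := ⟨_, h4.symm⟩
    have : M ∣ Q * M.reverse := by
      have h5 := this.mul_left ((-1) ^ N)
      rwa [← mul_assoc, ← mul_pow, neg_one_mul, neg_neg, one_pow, one_mul] at h5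
    exact hcop.dvd_of_dvd_mul_left this
  obtain ⟨C, hC⟩ := hdvd
  have hM1 : M.eval 1 ≠ 0 := by
    intro h
    obtain ⟨u, v, huv⟩ := hcop
    have := congrArg (Polynomial.eval 1) huv
    simp [h, hQ1] at this
  have hrne : M.reverse ≠ 0 := by simpa using hM
  have hCne : C ≠ 0 := by rintro rfl; rw [mul_zero] at hC; exact hrne hC
  have hCdeg : C.natDegree = 0 := by
    have e1 := congrArg Polynomial.natDegree hC
    rw [Polynomial.natDegree_mul hM hCne] at e1
    have e2 : M.reverse.natDegree ≤ M.natDegree := Polynomial.reverse_natDegree_le M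
    omega
  rw [Polynomial.eq_C_of_natDegree_eq_zero hCdeg] at hC
  have hev : M.reverse.eval 1 = M.eval 1 := by
    haveI : Invertible (1 : ℚ) := invertibleOne
    have := Polynomial.eval₂_reverse_mul_pow (RingHom.id ℚ) (1 : ℚ) M
    simpa [Polynomial.eval₂_id] using this
  have hc1 : C.coeff 0 = 1 := by
    have e1 := congrArg (Polynomial.eval 1) hC
    rw [hev, Polynomial.eval_mul, Polynomial.eval_C] at e1
    exact mul_left_cancel₀ hM1 (by linarith)
  rw [hc1, Polynomial.C_1, mul_one] at hC
  have haeq : a = b - (s + 1) := by omega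
  refine ⟨haeq, fun i hi => ?_⟩
  rw [← haeq] at hi ⊢
  conv_lhs => rw [← hC]
  rw [Polynomial.coeff_reverse, Polynomial.revAt_le hi]

theorem eval_one_zero (M Q : Polynomial ℚ) (f : ℕ → ℕ) (k : ℕ) (hf1 : ∀ n, 1 ≤ f n)
    (hfk : ∀ n, f n ≤ (n + 1) ^ k)
    (h : (M : PowerSeries ℚ) = (Q : PowerSeries ℚ) * PowerSeries.mk fun n => (f n : ℚ)) :
    Q.eval 1 = 0 := by
  have key : ∀ t : ℝ, 0 < t → t < 1 →
      |(Q.map (algebraMap ℚ ℝ)).eval t| ≤ (1 - t) * |(M.map (algebraMap ℚ ℝ)).eval t| := by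
    intro t ht0 ht1
    have hsf : Summable fun n : ℕ => (f n : ℝ) * t ^ n := by
      have h1 : Summable fun n : ℕ => ((n : ℝ) ^ k * t ^ n) :=
        summable_pow_mul_geometric_of_norm_lt_one k (by rw [Real.norm_eq_abs, abs_of_pos ht0]; exact ht1)
      have h2 := ((summable_nat_add_iff 1).2 h1).mul_left (t⁻¹)
      refine Summable.of_nonneg_of_le (fun n => by positivity) (fun n => ?_) h2
      have : (f n : ℝ) ≤ ((n + 1 : ℕ) : ℝ) ^ k := by exact_mod_cast hfk n
      calc (f n : ℝ) * t ^ n ≤ ((n + 1 : ℕ) : ℝ) ^ k * t ^ n := by gcongr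
        _ = _ := by rw [pow_succ]; field_simp
    have hpoly : ∀ p : Polynomial ℚ, HasSum (fun n : ℕ => ((p.coeff n : ℚ) : ℝ) * t ^ n)
        ((p.map (algebraMap ℚ ℝ)).eval t) := by
      intro p
      have e : (p.map (algebraMap ℚ ℝ)).eval t
          = ∑ n ∈ Finset.range (p.natDegree + 1), ((p.coeff n : ℚ) : ℝ) * t ^ n := by
        rw [Polynomial.eval_map_algebraMap, Polynomial.aeval_eq_sum_range]
        refine Finset.sum_congr rfl fun n _ => ?_
        rw [Algebra.smul_def]; rfl
      rw [e]
      refine hasSum_sum_of_ne_finset_zero fun n hn => ?_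
      rw [Polynomial.coeff_eq_zero_of_natDegree_lt (by simpa using hn)]; simp
    have hprod := tsum_mul_tsum_eq_tsum_sum_antidiagonal_of_summable_norm
      (hpoly Q).summable.norm hsf.norm
    have hco : ∀ n : ℕ, ∑ kl ∈ Finset.HasAntidiagonal.antidiagonal n,
        (((Q.coeff kl.1 : ℚ) : ℝ) * t ^ kl.1) * ((f kl.2 : ℝ) * t ^ kl.2)
          = ((M.coeff n : ℚ) : ℝ) * t ^ n := by
      intro n
      have := congrArg (PowerSeries.coeff n) h
      rw [Polynomial.coeff_coe, PowerSeries.coeff_mul] at this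
      rw [this]
      push_cast
      rw [Finset.sum_mul]
      refine Finset.sum_congr rfl fun x hx => ?_
      rw [← Finset.HasAntidiagonal.mem_antidiagonal.1 hx, pow_add]
      simp only [Polynomial.coeff_coe, PowerSeries.coeff_mk]
      push_cast
      ring
    simp only [hco] at hprod
    rw [(hpoly Q).tsum_eq, (hpoly M).tsum_eq] at hprod
    have hge : (1 - t)⁻¹ ≤ ∑' n : ℕ, (f n : ℝ) * t ^ n := by
      rw [← tsum_geometric_of_lt_one ht0.le ht1]
      refine (summable_geometric_of_lt_one ht0.le ht1).tsum_le_tsum (fun n => ?_) hsf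
      have : (1 : ℝ) ≤ f n := by exact_mod_cast hf1 n
      have h3 : 0 ≤ t ^ n := by positivity
      nlinarith
    have h1t : 0 < 1 - t := by linarith
    have hpos : 0 < ∑' n : ℕ, (f n : ℝ) * t ^ n := lt_of_lt_of_le (inv_pos.2 h1t) hge
    rw [← hprod, abs_mul, abs_of_pos hpos]
    have h5 : 1 ≤ (1 - t) * ∑' n : ℕ, (f n : ℝ) * t ^ n := by
      calc (1 : ℝ) = (1 - t) * (1 - t)⁻¹ := by field_simp
        _ ≤ _ := by gcongr
    have := abs_nonneg (Polynomial.eval t (Polynomial.map (algebraMap ℚ ℝ) Q))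
    nlinarith
  have hlim : |(Q.map (algebraMap ℚ ℝ)).eval 1| ≤ (1 - 1) * |(M.map (algebraMap ℚ ℝ)).eval 1| := by
    have c1 : Filter.Tendsto (fun t : ℝ => |(Q.map (algebraMap ℚ ℝ)).eval t|) (nhdsWithin 1 (Set.Iio 1))
        (nhds |(Q.map (algebraMap ℚ ℝ)).eval 1|) := by
      apply Filter.Tendsto.mono_left _ nhdsWithin_le_nhds
      exact ((Polynomial.continuous _).abs).tendsto 1
    have c2 : Filter.Tendsto (fun t : ℝ => (1 - t) * |(M.map (algebraMap ℚ ℝ)).eval t|)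
        (nhdsWithin 1 (Set.Iio 1)) (nhds ((1 - 1) * |(M.map (algebraMap ℚ ℝ)).eval 1|)) := by
      apply Filter.Tendsto.mono_left _ nhdsWithin_le_nhds
      exact ((continuous_const.sub continuous_id).mul ((Polynomial.continuous _).abs)).tendsto 1
    refine le_of_tendsto_of_tendsto c1 c2 ?_
    filter_upwards [Ioo_mem_nhdsLT (show (0 : ℝ) < 1 by norm_num)] with t ht
    exact key t ht.1 ht.2
  simp only [sub_self, zero_mul, abs_nonpos_iff] at hlim
  have := Polynomial.eval_map_algebraMap (B := ℝ) Q 1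
  rw [hlim] at this
  have h6 := Polynomial.aeval_algebraMap_apply ℝ (1 : ℚ) Q
  simp only [map_one] at h6
  rw [h6] at this
  simpa using this.symm
end HypEhr

namespace HypEhr

def pts {k r : ℕ} (E : Fin r → Finset (Fin k)) (n : ℤ) : Set (Fin k → ℤ) :=
  {m | (∀ i, 0 ≤ m i) ∧ ∀ i, ∑ j ∈ E i, m j ≤ n}

theorem pts_le {k r : ℕ} {E : Fin r → Finset (Fin k)} (hcover : ∀ v : Fin k, ∃ i, v ∈ E i)
    {n : ℤ} {m : Fin k → ℤ} (hm : m ∈ pts E n) (v : Fin k) : m v ≤ n := by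
  obtain ⟨i, hi⟩ := hcover v
  exact (Finset.single_le_sum (f := m) (fun j _ => hm.1 j) hi).trans (hm.2 i)

theorem pts_sub {k r : ℕ} {E : Fin r → Finset (Fin k)} (hcover : ∀ v : Fin k, ∃ i, v ∈ E i)
    (n : ℤ) : pts E n ⊆ Set.Icc 0 (fun _ => n) :=
  fun _ hm => ⟨fun i => hm.1 i, fun i => pts_le hcover hm i⟩

theorem pts_finite {k r : ℕ} {E : Fin r → Finset (Fin k)} (hcover : ∀ v : Fin k, ∃ i, v ∈ E i)
    (n : ℤ) : (pts E n).Finite :=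
  (Set.finite_Icc _ _).subset (pts_sub hcover n)

theorem ehr_eq {k r : ℕ} {E : Fin r → Finset (Fin k)} (hcover : ∀ v : Fin k, ∃ i, v ∈ E i)
    (n : ℕ) : ehr (hypergraphPolytope E) n = (pts E n).ncard := by
  unfold ehr
  congr 1
  ext m
  rcases Nat.eq_zero_or_pos n with rfl | hn
  · have hne : (hypergraphPolytope E).Nonempty := ⟨0, by simp [hypergraphPolytope]⟩
    simp only [Nat.cast_zero, Set.zero_smul_set hne]
    constructor
    · intro h
      have h0 : ∀ i, m i = 0 := by
        intro i
        have := congrFun (Set.mem_zero.1 h) i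
        simpa using this
      exact ⟨fun i => (h0 i).ge, fun i => by simp [h0]⟩
    · intro h
      apply Set.mem_zero.2
      funext i
      have h1 := pts_le hcover h i
      have h2 := h.1 i
      have : m i = 0 := le_antisymm h1 h2
      simp [this]
  · have hn' : (0 : ℝ) < n := by exact_mod_cast hn
    show (fun i => (m i : ℝ)) ∈ (n : ℝ) • hypergraphPolytope E ↔ _
    rw [Set.mem_smul_set_iff_inv_smul_mem₀ hn'.ne']
    simp only [hypergraphPolytope, pts, Set.mem_ofPred_eq, Pi.smul_apply, smul_eq_mul]
    refine and_congr (forall_congr' fun i => ?_) (forall_congr' fun i => ?_)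
    · rw [mul_nonneg_iff_of_pos_left (by positivity)]
      exact_mod_cast Iff.rfl
    · rw [← Finset.mul_sum, inv_mul_le_iff₀ hn', mul_one]
      exact_mod_cast Iff.rfl

theorem ehr_pos {k r : ℕ} {E : Fin r → Finset (Fin k)} (hcover : ∀ v : Fin k, ∃ i, v ∈ E i)
    (n : ℕ) : 1 ≤ ehr (hypergraphPolytope E) n := by
  rw [ehr_eq hcover]
  exact (Set.ncard_pos (pts_finite hcover n)).2 ⟨0, by simp [pts]⟩

theorem ehr_zero {k r : ℕ} {E : Fin r → Finset (Fin k)} (hcover : ∀ v : Fin k, ∃ i, v ∈ E i) :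
    ehr (hypergraphPolytope E) 0 = 1 := by
  rw [ehr_eq hcover, Set.ncard_eq_one]
  refine ⟨0, ?_⟩
  ext m
  simp only [Set.mem_singleton_iff]
  constructor
  · intro h
    funext i
    exact le_antisymm (pts_le hcover h i) (h.1 i)
  · rintro rfl; simp [pts]

theorem ehr_le {k r : ℕ} {E : Fin r → Finset (Fin k)} (hcover : ∀ v : Fin k, ∃ i, v ∈ E i)
    (n : ℕ) : ehr (hypergraphPolytope E) n ≤ (n + 1) ^ k := by
  rw [ehr_eq hcover]
  refine (Set.ncard_le_ncard (pts_sub hcover n) (Set.finite_Icc _ _)).trans ?_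
  rw [← Finset.coe_Icc, Set.ncard_coe_finset, Pi.card_Icc]
  simp

def edgeF {k r : ℕ} (E : Fin r → Finset (Fin k)) (i : Fin r) : Option (Fin k) → ℤ
  | none => 1
  | some v => if v ∈ E i then -1 else 0

def wt (k : ℕ) : Option (Fin k) → ℤ
  | none => 1
  | some _ => 0

def ext {k : ℕ} (n : ℤ) (m : Fin k → ℤ) : Option (Fin k) → ℤ
  | none => n
  | some v => m v

noncomputable def qq (k : ℕ) (t : ℝ) : Option (Fin k) → ℝ
  | none => t ^ k
  | some v => t ^ (v : ℕ)

theorem ext_inj {k : ℕ} (n : ℤ) : Function.Injective (ext (k := k) n) := by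
  intro m m' h
  funext v
  exact congrFun h (some v)

theorem dot_edge {k r : ℕ} (E : Fin r → Finset (Fin k)) (i : Fin r) {R : Type} [CommRing R]
    (α : Option (Fin k) → R) : dot (edgeF E i) α = α none - ∑ v ∈ E i, α (some v) := by
  simp [dot, Fintype.sum_option, edgeF, Int.cast_ite, ite_mul, sub_eq_add_neg]

theorem dot_wt {k : ℕ} {R : Type} [CommRing R] (α : Option (Fin k) → R) :
    dot (wt k) α = α none := by
  simp [dot, Fintype.sum_option, wt]

theorem qq_indep (k : ℕ) (t : ℝ) (ht : Transcendental ℤ t) : Indep (qq k t) := by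
  intro c hc
  have hp : (Polynomial.monomial k (c none) + ∑ v : Fin k, Polynomial.monomial (v : ℕ) (c (some v)) :
      Polynomial ℤ) = 0 := by
    by_contra hne
    refine ht ⟨_, hne, ?_⟩
    simp only [dot, Fintype.sum_option, qq] at hc
    simpa [Polynomial.aeval_monomial] using hc
  funext o
  cases o with
  | none =>
    have := congrArg (fun p => Polynomial.coeff p k) hp
    simp only [Polynomial.coeff_add, Polynomial.finset_sum_coeff, Polynomial.coeff_monomial] at this
    have h0 : ∑ v : Fin k, (if (v : ℕ) = k then c (some v) else 0) = 0 :=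
      Finset.sum_eq_zero fun v _ => if_neg (by have := v.2; omega)
    rw [h0] at this
    simpa using this
  | some u =>
    have := congrArg (fun p => Polynomial.coeff p (u : ℕ)) hp
    simp only [Polynomial.coeff_add, Polynomial.finset_sum_coeff, Polynomial.coeff_monomial] at this
    have hu : ¬ k = (u : ℕ) := by have := u.2; omega
    simpa [hu, Fin.val_inj] using this

theorem exists_trans (k : ℕ) : ∃ t : ℝ, Transcendental ℤ t ∧ (k : ℝ) + 1 < t := by
  have h := transcendental_liouvilleNumber (m := 2) le_rfl
  have hpos : 0 < liouvilleNumber ((2 : ℕ) : ℝ) := by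
    have h1 := LiouvilleNumber.partialSum_add_remainder (m := ((2:ℕ):ℝ)) (by norm_num) 0
    have h2 := LiouvilleNumber.remainder_pos (m := ((2:ℕ):ℝ)) (by norm_num) 0
    have h3 : 0 ≤ LiouvilleNumber.partialSum ((2:ℕ):ℝ) 0 := by
      unfold LiouvilleNumber.partialSum; positivity
    linarith
  refine ⟨liouvilleNumber ((2 : ℕ) : ℝ) + ((k + 1 : ℕ) : ℝ), ?_, by push_cast at hpos ⊢; linarith⟩
  intro hal
  apply h
  have := hal.sub (isAlgebraic_algebraMap (R := ℤ) (A := ℝ) ((k + 1 : ℕ) : ℤ))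
  simpa using this

theorem qq_pos {k : ℕ} {t : ℝ} (ht : (k : ℝ) + 1 < t) (o : Option (Fin k)) : 0 < qq k t o := by
  have : 0 < t := by have := Nat.cast_nonneg (α := ℝ) k; linarith
  cases o <;> simp [qq] <;> positivity

theorem qq_edge {k r : ℕ} (E : Fin r → Finset (Fin k)) (i : Fin r) {t : ℝ} (ht : (k : ℝ) + 1 < t) :
    0 < dot (edgeF E i) (qq k t) := by
  rw [dot_edge]
  have hk := Nat.cast_nonneg (α := ℝ) k
  have ht0 : 0 < t := by linarith
  have h1 : ∑ v ∈ E i, qq k t (some v) ≤ ∑ v : Fin k, qq k t (some v) :=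
    Finset.sum_le_sum_of_subset_of_nonneg (Finset.subset_univ _) fun v _ _ => (qq_pos ht _).le
  rcases Nat.eq_zero_or_pos k with rfl | hkp
  · have := qq_pos ht none
    simp at h1
    linarith
  · have h2 : ∑ v : Fin k, qq k t (some v) ≤ ∑ v : Fin k, t ^ (k - 1) := by
      refine Finset.sum_le_sum fun v _ => ?_
      exact pow_le_pow_right₀ (by linarith) (by have := v.2; omega)
    have h3 : ∑ v : Fin k, t ^ (k - 1) = k * t ^ (k - 1) := by simp
    have h4 : qq k t none = t * t ^ (k - 1) := by
      show t ^ k = _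
      rw [← pow_succ']; congr 1; omega
    have h5 : 0 < t ^ (k - 1) := by positivity
    rw [h4]
    nlinarith

theorem lp_pos {a : ℤ} {p : ℝ} (hp : 0 < p) : lp a p ↔ 0 ≤ a := by
  unfold lp; constructor
  · rintro (h | h) <;> omega
  · intro h
    rcases h.lt_or_eq with h | h
    · exact Or.inl h
    · exact Or.inr ⟨h.symm, hp⟩

theorem lp_neg {a : ℤ} {p : ℝ} (hp : 0 < p) : lp a (-p) ↔ 0 < a := by
  unfold lp; constructor
  · rintro (h | h)
    · exact h
    · linarith
  · exact Or.inl

theorem dot_neg {k : ℕ} (c : Option (Fin k) → ℤ) (q : Option (Fin k) → ℝ) : dot c (-q) = -dot c q := by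
  simp [dot]

theorem FF_plus {k r : ℕ} {E : Fin r → Finset (Fin k)} (hcover : ∀ v : Fin k, ∃ i, v ∈ E i)
    {t : ℝ} (ht : (k : ℝ) + 1 < t) :
    FF (List.ofFn (edgeF E)) (wt k) (qq k t) = ehrSeries (hypergraphPolytope E) := by
  ext n
  simp only [FF, ehrSeries, PowerSeries.coeff_mk]
  rw [ehr_eq hcover, ← Set.ncard_image_of_injective _ (ext_inj (n : ℤ))]
  congr 2
  ext α
  constructor
  · rintro ⟨h1, h2, h3⟩
    rw [dot_wt] at h3
    refine ⟨fun v => α (some v), ⟨fun v => (h1 _).nonneg, fun i => ?_⟩, ?_⟩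
    · have := (h2 (edgeF E i) (by simp [List.mem_ofFn])).nonneg
      rw [dot_edge, h3] at this
      linarith
    · funext o; cases o
      · exact h3.symm
      · rfl
  · rintro ⟨m, ⟨h1, h2⟩, rfl⟩
    refine ⟨fun o => ?_, fun c hc => ?_, ?_⟩
    · rw [lp_pos (qq_pos ht o)]
      cases o
      · exact Int.natCast_nonneg n
      · exact h1 _
    · obtain ⟨i, rfl⟩ := (List.mem_ofFn' _ _).1 hc
      rw [lp_pos (qq_edge E i ht), dot_edge]
      have := h2 i
      simp only [ext]
      linarith
    · rw [dot_wt]; rfl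

theorem FF_minus {k r s : ℕ} {E : Fin r → Finset (Fin k)} (hcover : ∀ v : Fin k, ∃ i, v ∈ E i)
    (huniform : ∀ i, (E i).card = s) (hr : 0 < r)
    {t : ℝ} (ht : (k : ℝ) + 1 < t) :
    FF (List.ofFn (edgeF E)) (wt k) (-(qq k t)) =
      PowerSeries.X ^ (s + 1) * ehrSeries (hypergraphPolytope E) := by
  ext n
  rw [PowerSeries.coeff_X_pow_mul']
  simp only [FF, ehrSeries, PowerSeries.coeff_mk]
  have hsh : ∀ (m : Fin k → ℤ) (i : Fin r), ∑ j ∈ E i, (m j + 1) = ∑ j ∈ E i, m j + s := by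
    intro m i
    rw [Finset.sum_add_distrib]; simp [huniform i]
  have hinj : Function.Injective (fun m : Fin k → ℤ => ext (n : ℤ) (fun v => m v + 1)) := by
    intro m m' h
    have := ext_inj _ h
    funext v
    have := congrFun this v
    simpa using this
  have hS : SS (List.ofFn (edgeF E)) (wt k) (-(qq k t)) n =
      (fun m : Fin k → ℤ => ext (n : ℤ) (fun v => m v + 1)) '' pts E ((n : ℤ) - (s + 1)) := by
    ext α
    constructor
    · rintro ⟨h1, h2, h3⟩
      rw [dot_wt] at h3
      refine ⟨fun v => α (some v) - 1, ⟨fun v => ?_, fun i => ?_⟩, ?_⟩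
      · have := h1 (some v)
        rw [Pi.neg_apply, lp_neg (qq_pos ht _)] at this
        show 0 ≤ α (some v) - 1
        omega
      · have := h2 (edgeF E i) (by simp [List.mem_ofFn])
        rw [dot_neg, lp_neg (qq_edge E i ht), dot_edge, h3] at this
        have h4 := hsh (fun v => α (some v) - 1) i
        simp only [sub_add_cancel] at h4
        linarith
      · funext o; cases o
        · exact h3.symm
        · simp [ext]
    · rintro ⟨m, ⟨h1, h2⟩, rfl⟩
      have hn : (s : ℤ) + 1 ≤ n := by
        have := h2 ⟨0, hr⟩
        have h5 : 0 ≤ ∑ j ∈ E ⟨0, hr⟩, m j := Finset.sum_nonneg fun j _ => h1 j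
        linarith
      refine ⟨fun o => ?_, fun c hc => ?_, ?_⟩
      · rw [Pi.neg_apply, lp_neg (qq_pos ht o)]
        cases o with
        | none => show (0 : ℤ) < n; omega
        | some v => have := h1 v; show 0 < m v + 1; omega
      · obtain ⟨i, rfl⟩ := (List.mem_ofFn' _ _).1 hc
        rw [dot_neg, lp_neg (qq_edge E i ht), dot_edge]
        have := h2 i
        simp only [ext]
        rw [hsh]
        linarith
      · rw [dot_wt]; rfl
  rw [hS, Set.ncard_image_of_injective _ hinj]
  split_ifs with hn
  · rw [ehr_eq hcover]
    congr 3
    push_cast [Nat.cast_sub hn]; ring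
  · have : pts E ((n : ℤ) - (s + 1)) = ∅ := by
      ext m
      simp only [Set.mem_empty_iff_false, iff_false]
      rintro ⟨h1, h2⟩
      have := h2 ⟨0, hr⟩
      have h5 : 0 ≤ ∑ j ∈ E ⟨0, hr⟩, m j := Finset.sum_nonneg fun j _ => h1 j
      omega
    simp [this]

theorem hyp_edge {k r : ℕ} {E : Fin r → Finset (Fin k)} (hcover : ∀ v : Fin k, ∃ i, v ∈ E i) :
    Hyp (List.ofFn (edgeF E)) (wt k) := by
  constructor
  · intro α h1 _
    rw [dot_wt]; exact h1 _
  · intro n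
    refine ((pts_finite hcover n).image (ext n)).subset ?_
    rintro α ⟨h1, h2, h3⟩
    rw [dot_wt] at h3
    refine ⟨fun v => α (some v), ⟨fun v => h1 _, fun i => ?_⟩, ?_⟩
    · have := h2 (edgeF E i) (by simp [List.mem_ofFn])
      rw [dot_edge, h3] at this
      linarith
    · funext o; cases o
      · exact h3.symm
      · rfl

end HypEhr

theorem stmt6 {k r s : ℕ} (E : Fin r → Finset (Fin k))
    (hsimple : HypSimple E) (hconn : HypConnected E)
    (hcover : ∀ v : Fin k, ∃ i, v ∈ E i)
    (huniform : ∀ i, (E i).card = s)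
    (M Q : Polynomial ℚ) (hcop : IsCoprime M Q) (hQ0 : Q.coeff 0 = 1)
    (hMQ : (M : PowerSeries ℚ) = (Q : PowerSeries ℚ) * ehrSeries (hypergraphPolytope E)) :
    M.natDegree = Q.natDegree - (s + 1) ∧
      ∀ i ≤ Q.natDegree - (s + 1),
        M.coeff i = M.coeff (Q.natDegree - (s + 1) - i) := by
  have hc0 : PowerSeries.constantCoeff (ehrSeries (hypergraphPolytope E)) = 1 := by
    rw [← PowerSeries.coeff_zero_eq_constantCoeff_apply]
    simp [ehrSeries, HypEhr.ehr_zero hcover]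
  have hM0 : M.coeff 0 = 1 := by
    have := congrArg (PowerSeries.coeff 0) hMQ
    rw [Polynomial.coeff_coe, PowerSeries.coeff_zero_eq_constantCoeff_apply, map_mul, hc0,
      ← PowerSeries.coeff_zero_eq_constantCoeff_apply, Polynomial.coeff_coe, hQ0] at this
    rw [this, one_mul]
  have hQ1 : Q.eval 1 = 0 :=
    HypEhr.eval_one_zero M Q _ k (HypEhr.ehr_pos hcover) (HypEhr.ehr_le hcover) hMQ
  rcases Nat.eq_zero_or_pos k with rfl | hk
  · have hser : ehrSeries (hypergraphPolytope E) * (1 - PowerSeries.X) = 1 := by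
      have : ehrSeries (hypergraphPolytope E) = PowerSeries.mk 1 := by
        ext n
        have h1 := HypEhr.ehr_pos hcover n
        have h2 := HypEhr.ehr_le hcover n
        have : ehr (hypergraphPolytope E) n = 1 := by
          rw [pow_zero] at h2; omega
        simp [ehrSeries, this]
      rw [this]; exact PowerSeries.mk_one_mul_one_sub_eq_one ℚ
    have hMX : M * (1 - Polynomial.X) = Q := by
      apply Polynomial.coe_injective ℚ
      push_cast
      rw [hMQ, mul_assoc, hser, mul_one]
    have hunit : IsUnit M := hcop.isUnit_of_dvd' dvd_rfl ⟨_, hMX.symm⟩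
    have hd : M.natDegree = 0 := Polynomial.natDegree_eq_zero_of_isUnit hunit
    have hQd : Q.natDegree ≤ 1 := by
      rw [← hMX]
      refine Polynomial.natDegree_mul_le.trans ?_
      have : (1 - Polynomial.X : Polynomial ℚ).natDegree ≤ 1 :=
        (Polynomial.natDegree_sub_le _ _).trans (by simp)
      omega
    have hz : Q.natDegree - (s + 1) = 0 := by omega
    rw [hz]
    refine ⟨hd, fun i hi => ?_⟩
    obtain rfl : i = 0 := by omega
    rfl
  · have hr : 0 < r := by
      obtain ⟨i, -⟩ := hcover ⟨0, hk⟩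
      exact lt_of_le_of_lt (Nat.zero_le _) i.2
    obtain ⟨t, htr, ht⟩ := HypEhr.exists_trans k
    obtain ⟨A, B, D, hA, hB, hB0, hBD, h1, h2⟩ := HypEhr.rec_main _ (List.ofFn (HypEhr.edgeF E)) rfl
      (HypEhr.wt k) (HypEhr.qq k t) (HypEhr.qq_indep k t htr) (HypEhr.hyp_edge hcover)
    rw [HypEhr.FF_plus hcover ht] at h1
    rw [HypEhr.FF_minus hcover huniform hr ht] at h2
    refine HypEhr.algebra_end (N := Fintype.card (Option (Fin k))) hcop hQ0 hM0 hA hB hBD hB0 ?_ ?_ hQ1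
    · apply Polynomial.coe_injective ℚ
      rw [Polynomial.coe_mul, Polynomial.coe_mul, hMQ, ← h1]; ring
    · apply Polynomial.coe_injective ℚ
      rw [Polynomial.coe_mul, Polynomial.coe_mul, Polynomial.coe_mul, Polynomial.coe_mul, hMQ,
        Polynomial.coe_pow, Polynomial.coe_X]
      rw [Polynomial.coe_mul] at h2
      linear_combination (Q : PowerSeries ℚ) * h2
end
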